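/- Let d ≥ 2 and let P_1, …, P_d be convex bodies in ℝ^d. Then V(P_1, P_2, P_3, …, P_d)^2 ≥ V(P_1, P_1, P_3, …, P_d) · V(P_2, P_2, P_3, …, P_d) (the Aleksandrov–Fenchel inequality). -/

import Mathlib

open Pointwise MeasureTheory

/-- The mixed volume of `d` convex bodies in `ℝ^d`:
`V(P_1, …, P_d) = ∑_{S ⊆ {1,…,d}} (−1)^{d−|S|} vol(∑_{i∈S} P_i)`. -/
noncomputable def mixedVolume {d : ℕ} (P : Fin d → Set (EuclideanSpace ℝ (Fin d))) : ℝ :=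
  ∑ S : Finset (Fin d), (-1 : ℝ) ^ (d - S.card) * (volume (∑ i ∈ S, P i)).toReal

namespace MvPolynomial

variable {ι : Type} [Fintype ι]

/-- The directional derivative of a real polynomial, as a linear function of the direction. -/
noncomputable def dirDeriv : (ι → ℝ) →ₗ[ℝ] MvPolynomial ι ℝ →ₗ[ℝ] MvPolynomial ι ℝ where
  toFun x := ∑ i, x i • (pderiv i : Derivation ℝ (MvPolynomial ι ℝ) _).toLinearMap
  map_add' x y := by simp [add_smul, Finset.sum_add_distrib]
  map_smul' c x := by simp [mul_smul, Finset.smul_sum]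

theorem dirDeriv_apply (x : ι → ℝ) (p : MvPolynomial ι ℝ) :
    dirDeriv x p = ∑ i, x i • pderiv i p := by
  simp [dirDeriv]

theorem dirDeriv_C (x : ι → ℝ) (r : ℝ) : dirDeriv x (C r) = 0 := by
  simp [dirDeriv_apply]

theorem dirDeriv_X (x : ι → ℝ) (i : ι) : dirDeriv x (X i) = C (x i) := by
  classical
  simp [dirDeriv_apply, pderiv_X, Pi.single_apply, smul_eq_C_mul]

theorem dirDeriv_mul (x : ι → ℝ) (p q : MvPolynomial ι ℝ) :
    dirDeriv x (p * q) = dirDeriv x p * q + p * dirDeriv x q := by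
  simp only [dirDeriv_apply, pderiv_mul, smul_add, Finset.sum_add_distrib, Finset.sum_mul,
    Finset.mul_sum, smul_mul_assoc, mul_smul_comm]

theorem dirDeriv_comm (x y : ι → ℝ) (p : MvPolynomial ι ℝ) :
    dirDeriv x (dirDeriv y p) = dirDeriv y (dirDeriv x p) := by
  induction p using MvPolynomial.induction_on with
  | C a => simp [dirDeriv_C]
  | add p q hp hq => simp [hp, hq]
  | mul_X p i hp =>
    simp only [dirDeriv_mul, dirDeriv_X, map_add, dirDeriv_C, hp]
    ring

theorem IsHomogeneous.dirDeriv {n : ℕ} {p : MvPolynomial ι ℝ} (hp : p.IsHomogeneous n)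
    (x : ι → ℝ) : (dirDeriv x p).IsHomogeneous (n - 1) := by
  rw [dirDeriv_apply]
  refine IsHomogeneous.sum _ _ _ fun i _ => ?_
  rw [smul_eq_C_mul]
  exact hp.pderiv.C_mul _

theorem IsHomogeneous.eval_dirDeriv_self {n : ℕ} {p : MvPolynomial ι ℝ} (hp : p.IsHomogeneous n)
    (x : ι → ℝ) : eval x (MvPolynomial.dirDeriv x p) = n * eval x p := by
  have := congrArg (eval x) hp.sum_X_mul_pderiv
  simpa [dirDeriv_apply, smul_eq_C_mul] using this

omit [Fintype ι] in
theorem IsHomogeneous.eval_smul {n : ℕ} {p : MvPolynomial ι ℝ} (hp : p.IsHomogeneous n)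
    (r : ℝ) (x : ι → ℝ) : eval (r • x) p = r ^ n * eval x p := by
  rw [eval_eq, eval_eq, Finset.mul_sum]
  refine Finset.sum_congr rfl fun m hm => ?_
  have h := hp (mem_support_iff.1 hm)
  have h2 : ∏ i ∈ m.support, r ^ m i = r ^ n := by
    rw [Finset.prod_pow_eq_pow_sum, ← h]
    simp [Finsupp.weight_apply, Finsupp.sum]
  simp only [Pi.smul_apply, smul_eq_mul, mul_pow, Finset.prod_mul_distrib, h2]
  ring

theorem hasDerivAt_eval_line (p : MvPolynomial ι ℝ) (x v : ι → ℝ) (r : ℝ) :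
    HasDerivAt (fun r : ℝ => eval (x + r • v) p) (eval (x + r • v) (dirDeriv v p)) r := by
  induction p using MvPolynomial.induction_on with
  | C a => simpa [dirDeriv_C] using hasDerivAt_const r a
  | add p q hp hq => simpa using hp.fun_add hq
  | mul_X p i hp =>
    have h : HasDerivAt (fun r : ℝ => x i + r * v i) (v i) r := by
      simpa using ((hasDerivAt_id r).mul_const (v i)).const_add (x i)
    simpa [dirDeriv_mul, dirDeriv_X] using hp.fun_mul h

theorem eq_of_eqOn_isOpen {p q : MvPolynomial ι ℝ} {U : Set (ι → ℝ)} (hU : IsOpen U)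
    (hne : U.Nonempty) (h : ∀ x ∈ U, eval x p = eval x q) : p = q := by
  obtain ⟨x, hx⟩ := hne
  obtain ⟨ε, hε, hb⟩ := Metric.isOpen_iff.1 hU x hx
  refine funext_set (fun i => Metric.ball (x i) ε) (fun i => ?_) fun y hy => h y (hb ?_)
  · rw [Real.ball_eq_Ioo]
    exact Set.Ioo_infinite (by linarith)
  · rw [ball_pi _ hε]; exact hy

/-- Iterated directional derivatives of a polynomial along a list of directions, evaluated at the
origin. For a homogeneous polynomial of degree the length of the list this is its polarization. -/
noncomputable def polar : List (ι → ℝ) → MvPolynomial ι ℝ →ₗ[ℝ] ℝ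
  | [] => (aeval (0 : ι → ℝ)).toLinearMap
  | x :: l => (polar l).comp (dirDeriv x)

theorem polar_nil (p : MvPolynomial ι ℝ) : polar [] p = eval 0 p := by
  simp [polar]

theorem polar_cons (x : ι → ℝ) (l : List (ι → ℝ)) (p : MvPolynomial ι ℝ) :
    polar (x :: l) p = polar l (dirDeriv x p) := rfl

theorem polar_perm {l l' : List (ι → ℝ)} (h : l.Perm l') (p : MvPolynomial ι ℝ) :
    polar l p = polar l' p := by
  induction h generalizing p with
  | nil => rfl
  | cons x _ ih => exact ih _
  | swap x y l => simp only [polar_cons, dirDeriv_comm]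
  | trans _ _ h1 h2 => exact (h1 p).trans (h2 p)

theorem IsHomogeneous.polar_replicate {n : ℕ} {p : MvPolynomial ι ℝ} (hp : p.IsHomogeneous n)
    (x : ι → ℝ) : polar (List.replicate n x) p = n.factorial * eval x p := by
  induction n generalizing p with
  | zero =>
    have h := hp.eval_smul 0 x
    simp only [zero_smul, pow_zero, one_mul] at h
    simp [polar, ← h]
  | succ n ih =>
    rw [List.replicate_succ, polar_cons, ih (by simpa using hp.dirDeriv x),
      hp.eval_dirDeriv_self, Nat.factorial_succ]
    push_cast
    ring

/-- Iterated forward differences along a list of directions. -/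
def iterDiff (F : (ι → ℝ) → ℝ) : List (ι → ℝ) → (ι → ℝ) → ℝ
  | [], x => F x
  | s :: l, x => iterDiff F l (x + s) - iterDiff F l x

omit [Fintype ι] in
theorem iterDiff_eq_sum {κ : Type} [DecidableEq κ] (F : (ι → ℝ) → ℝ) (s : κ → ι → ℝ) (l : List κ)
    (hl : l.Nodup) (x : ι → ℝ) :
    iterDiff F (l.map s) x =
      ∑ S ∈ l.toFinset.powerset, (-1 : ℝ) ^ (l.length - S.card) * F (x + ∑ i ∈ S, s i) := by
  induction l generalizing x with
  | nil => simp [iterDiff]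
  | cons a l ih =>
    have ha : a ∉ l.toFinset := by simpa using (List.nodup_cons.1 hl).1
    have hl' := (List.nodup_cons.1 hl).2
    have hlen : l.toFinset.card = l.length := List.toFinset_card_of_nodup hl'
    rw [List.toFinset_cons, Finset.sum_powerset_insert ha, List.map_cons, iterDiff, ih hl', ih hl',
      sub_eq_neg_add, ← Finset.sum_neg_distrib]
    congr 1
    · refine Finset.sum_congr rfl fun S hS => ?_
      have := Finset.card_le_card (Finset.mem_powerset.1 hS)
      rw [List.length_cons, show l.length + 1 - S.card = (l.length - S.card) + 1 by omega, pow_succ]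
      ring
    · refine Finset.sum_congr rfl fun S hS => ?_
      have haS : a ∉ S := fun h => ha (Finset.mem_powerset.1 hS h)
      rw [List.length_cons, Finset.card_insert_of_notMem haS, Finset.sum_insert haS,
        Nat.add_sub_add_right, add_assoc]

theorem hasDerivAt_iterDiff (p : MvPolynomial ι ℝ) (l : List (ι → ℝ)) (x v : ι → ℝ) (r : ℝ) :
    HasDerivAt (fun r : ℝ => iterDiff (fun y => eval y p) l (x + r • v))
      (iterDiff (fun y => eval y (dirDeriv v p)) l (x + r • v)) r := by
  induction l generalizing x with
  | nil => exact hasDerivAt_eval_line p x v r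
  | cons s l ih =>
    have e : ∀ r : ℝ, x + r • v + s = x + s + r • v := fun r => add_right_comm _ _ _
    simp only [iterDiff, e]
    exact (ih (x + s)).fun_sub (ih x)

theorem IsHomogeneous.iterDiff_eq_polar {p : MvPolynomial ι ℝ} (l : List (ι → ℝ))
    (hp : p.IsHomogeneous l.length) (x : ι → ℝ) :
    iterDiff (fun y => eval y p) l x = polar l p := by
  induction l generalizing p x with
  | nil =>
    have h := IsHomogeneous.eval_smul (n := 0) hp 0 x
    simp only [zero_smul, pow_zero, one_mul] at h
    rw [polar_nil, h, iterDiff]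
  | cons s l ih =>
    have hs : (MvPolynomial.dirDeriv s p).IsHomogeneous l.length := by simpa using hp.dirDeriv s
    have hd : ∀ r : ℝ, HasDerivAt (fun r : ℝ => iterDiff (fun y => eval y p) l (x + r • s)
        - r * polar (s :: l) p) 0 r := fun r => by
      have h := hasDerivAt_iterDiff p l x s r
      rw [ih hs] at h
      simpa [polar_cons] using h.fun_sub ((hasDerivAt_id r).mul_const (polar (s :: l) p))
    have := is_const_of_deriv_eq_zero (fun r => (hd r).differentiableAt) (fun r => (hd r).deriv) 1 0
    simp only [one_smul, zero_smul, add_zero, one_mul, zero_mul, sub_zero] at this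
    simp only [iterDiff]
    linarith

theorem IsHomogeneous.sum_finset_eq_polar {d : ℕ} {p : MvPolynomial ι ℝ} (hp : p.IsHomogeneous d)
    (s : Fin d → ι → ℝ) :
    ∑ S : Finset (Fin d), (-1 : ℝ) ^ (d - S.card) * eval (∑ i ∈ S, s i) p =
      polar ((List.finRange d).map s) p := by
  rw [← IsHomogeneous.iterDiff_eq_polar (x := 0) _ (by simpa using hp),
    iterDiff_eq_sum _ _ _ (List.nodup_finRange d)]
  simp [List.toFinset_finRange]

end MvPolynomial

theorem volume_add_volume_le_of_isCompact {A B D : Set ℝ} (hA : IsCompact A) (hB : IsCompact B)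
    (hA0 : A.Nonempty) (hB0 : B.Nonempty) (h : A + B ⊆ D) : volume A + volume B ≤ volume D := by
  obtain ⟨a, ha, hamax⟩ := hA.exists_isMaxOn hA0 continuousOn_id
  obtain ⟨b, hb, hbmin⟩ := hB.exists_isMinOn hB0 continuousOn_id
  have h1 : volume ((fun x => x + b) '' A) = volume A := by simp
  have h2 : volume ((fun x => a + x) '' B) = volume B := by simp
  have hm : MeasurableSet ((fun x => a + x) '' B) :=
    (hB.image (continuous_const_add a)).measurableSet
  have hinter : volume (((fun x => x + b) '' A) ∩ ((fun x => a + x) '' B)) = 0 := by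
    refine measure_mono_null (t := {a + b}) ?_ (by simp)
    rintro _ ⟨⟨x, hx, rfl⟩, ⟨y, hy, hxy⟩⟩
    have hx' : x ≤ a := hamax hx
    have hy' : b ≤ y := hbmin hy
    simp only [Set.mem_singleton_iff] at *
    linarith
  have := measure_union_add_inter (μ := volume) ((fun x => x + b) '' A) hm
  rw [hinter, h1, h2, add_zero] at this
  rw [← this]
  refine measure_mono (Set.union_subset ?_ ?_)
  · rintro _ ⟨x, hx, rfl⟩; exact h (Set.add_mem_add hx hb)
  · rintro _ ⟨x, hx, rfl⟩; exact h (Set.add_mem_add ha hx)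

/-- The Brunn–Minkowski inequality on the real line. -/
theorem volume_add_volume_le_of_add_subset {A B D : Set ℝ} (hA : MeasurableSet A)
    (hB : MeasurableSet B) (hA0 : A.Nonempty) (hB0 : B.Nonempty) (h : A + B ⊆ D) :
    volume A + volume B ≤ volume D := by
  obtain ⟨a, ha⟩ := hA0
  obtain ⟨b, hb⟩ := hB0
  rw [hA.measure_eq_iSup_isCompact, hB.measure_eq_iSup_isCompact]
  simp only [iSup_and']
  have he : ∀ E : Set ℝ, ∃ K, K ⊆ E ∧ IsCompact K := fun E =>
    ⟨∅, Set.empty_subset _, isCompact_empty⟩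
  refine ENNReal.biSup_add_biSup_le (he A) (he B) fun K hK L hL => ?_
  calc volume K + volume L ≤ volume (insert a K) + volume (insert b L) :=
        add_le_add (measure_mono (Set.subset_insert _ _)) (measure_mono (Set.subset_insert _ _))
    _ ≤ volume D := volume_add_volume_le_of_isCompact (hK.2.insert a) (hL.2.insert b)
        (Set.insert_nonempty _ _) (Set.insert_nonempty _ _)
        ((Set.add_subset_add (Set.insert_subset ha hK.1) (Set.insert_subset hb hL.1)).trans h)

theorem ENNReal.four_mul_mul_le_add_sq (a b : ENNReal) : 4 * (a * b) ≤ (a + b) ^ 2 := by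
  by_cases ha : a = ⊤
  · simp [ha]
  by_cases hb : b = ⊤
  · simp [hb]
  lift a to NNReal using ha
  lift b to NNReal using hb
  norm_cast
  rw [← NNReal.coe_le_coe]
  push_cast
  nlinarith [sq_nonneg ((a : ℝ) - b)]

theorem lintegral_add_lintegral_le_of_sup_eq_one {f g h : ℝ → ℝ} (hf : Measurable f)
    (hg : Measurable g) (hh : Measurable h) (hf0 : ∀ x, 0 ≤ f x) (hg0 : ∀ x, 0 ≤ g x)
    (hh0 : ∀ x, 0 ≤ h x) (hf1 : ∀ x, f x ≤ 1) (hg1 : ∀ x, g x ≤ 1)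
    (hfs : ∀ r < 1, ∃ x, r < f x) (hgs : ∀ r < 1, ∃ x, r < g x)
    (hfg : ∀ x y, f x * g y ≤ h (x + y) ^ 2) :
    (∫⁻ x, ENNReal.ofReal (f x)) + ∫⁻ x, ENNReal.ofReal (g x) ≤ ∫⁻ x, ENNReal.ofReal (h x) := by
  rw [lintegral_eq_lintegral_meas_lt _ (Filter.Eventually.of_forall hf0) hf.aemeasurable,
    lintegral_eq_lintegral_meas_lt _ (Filter.Eventually.of_forall hg0) hg.aemeasurable,
    lintegral_eq_lintegral_meas_lt _ (Filter.Eventually.of_forall hh0) hh.aemeasurable,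
    ← lintegral_add_left]
  · refine setLIntegral_mono' measurableSet_Ioi fun r hr => ?_
    have hr0 : (0 : ℝ) < r := hr
    rcases lt_or_ge r 1 with h1 | h1
    · refine volume_add_volume_le_of_add_subset (measurableSet_lt measurable_const hf)
        (measurableSet_lt measurable_const hg) (hfs r h1) (hgs r h1) ?_
      rintro _ ⟨x, hx, y, hy, rfl⟩
      have hx' : r < f x := hx
      have hy' : r < g y := hy
      have := hfg x y
      exact lt_of_pow_lt_pow_left₀ 2 (hh0 _) (by nlinarith)
    · have e1 : {a | r < f a} = ∅ := by
        ext a; simpa using (hf1 a).trans h1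
      have e2 : {a | r < g a} = ∅ := by
        ext a; simpa using (hg1 a).trans h1
      simp [e1, e2]
  · exact Antitone.measurable fun a b hab => measure_mono fun x hx => lt_of_le_of_lt hab hx

/-- The Prékopa–Leindler inequality on the real line, for bounded functions. -/
theorem prekopa_leindler_real {f g h : ℝ → ℝ} (hf : Measurable f)
    (hg : Measurable g) (hh : Measurable h) (hf0 : ∀ x, 0 ≤ f x) (hg0 : ∀ x, 0 ≤ g x)
    (hh0 : ∀ x, 0 ≤ h x) (hfb : BddAbove (Set.range f)) (hgb : BddAbove (Set.range g))
    (hfg : ∀ x y, f x * g y ≤ h (x + y) ^ 2) :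
    4 * ((∫⁻ x, ENNReal.ofReal (f x)) * ∫⁻ x, ENNReal.ofReal (g x)) ≤
      (∫⁻ x, ENNReal.ofReal (h x)) ^ 2 := by
  have hfle : ∀ x, f x ≤ ⨆ x, f x := le_ciSup hfb
  have hgle : ∀ x, g x ≤ ⨆ x, g x := le_ciSup hgb
  set a := ⨆ x, f x with ha
  set b := ⨆ x, g x with hb
  rcases (le_trans (hf0 0) (hfle 0)).eq_or_lt with ha0 | ha0
  · have : ∀ x, f x = 0 := fun x => le_antisymm (ha0 ▸ hfle x) (hf0 x)
    simp [this]
  rcases (le_trans (hg0 0) (hgle 0)).eq_or_lt with hb0 | hb0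
  · have : ∀ x, g x = 0 := fun x => le_antisymm (hb0 ▸ hgle x) (hg0 x)
    simp [this]
  set c := √(a * b) with hc
  have hc0 : 0 < c := Real.sqrt_pos.2 (mul_pos ha0 hb0)
  have hc2 : c ^ 2 = a * b := Real.sq_sqrt (mul_pos ha0 hb0).le
  have key := lintegral_add_lintegral_le_of_sup_eq_one (f := fun x => f x / a)
    (g := fun x => g x / b) (h := fun x => h x / c) (hf.div_const a) (hg.div_const b)
    (hh.div_const c) (fun x => div_nonneg (hf0 x) ha0.le) (fun x => div_nonneg (hg0 x) hb0.le)
    (fun x => div_nonneg (hh0 x) hc0.le) (fun x => (div_le_one ha0).2 (hfle x))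
    (fun x => (div_le_one hb0).2 (hgle x))
    (fun r hr => by
      obtain ⟨x, hx⟩ := exists_lt_of_lt_ciSup (show r * a < ⨆ x, f x by
        rw [← ha]; nlinarith)
      exact ⟨x, (lt_div_iff₀ ha0).2 hx⟩)
    (fun r hr => by
      obtain ⟨x, hx⟩ := exists_lt_of_lt_ciSup (show r * b < ⨆ x, g x by
        rw [← hb]; nlinarith)
      exact ⟨x, (lt_div_iff₀ hb0).2 hx⟩)
    (fun x y => by
      rw [div_mul_div_comm, div_pow, hc2]
      exact div_le_div_of_nonneg_right (hfg x y) (mul_pos ha0 hb0).le)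
  have scale : ∀ (u : ℝ → ℝ) (r : ℝ), 0 < r → Measurable u →
      (∫⁻ x, ENNReal.ofReal (u x)) = ENNReal.ofReal r * ∫⁻ x, ENNReal.ofReal (u x / r) := by
    intro u r hr hu
    rw [← lintegral_const_mul _ (hu.div_const r).ennreal_ofReal]
    refine lintegral_congr fun x => ?_
    rw [← ENNReal.ofReal_mul hr.le, mul_div_cancel₀ _ hr.ne']
  rw [scale f a ha0 hf, scale g b hb0 hg, scale h c hc0 hh]
  calc 4 * (ENNReal.ofReal a * (∫⁻ x, ENNReal.ofReal (f x / a)) *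
        (ENNReal.ofReal b * ∫⁻ x, ENNReal.ofReal (g x / b)))
      = ENNReal.ofReal c ^ 2 * (4 * ((∫⁻ x, ENNReal.ofReal (f x / a)) *
          ∫⁻ x, ENNReal.ofReal (g x / b))) := by
        rw [← ENNReal.ofReal_pow hc0.le, hc2, ENNReal.ofReal_mul ha0.le]; ring
    _ ≤ ENNReal.ofReal c ^ 2 * (∫⁻ x, ENNReal.ofReal (h x / c)) ^ 2 := by
        gcongr
        exact (ENNReal.four_mul_mul_le_add_sq _ _).trans (by gcongr)
    _ = _ := by ring

/-- The multiplicative form of the Brunn–Minkowski inequality. -/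
theorem volume_mul_volume_le_sq {n : ℕ} {K L : Set (Fin n → ℝ)} (hK : IsCompact K)
    (hL : IsCompact L) : 4 ^ n * (volume K * volume L) ≤ volume (K + L) ^ 2 := by
  induction n with
  | zero =>
    rcases K.eq_empty_or_nonempty with rfl | hK0
    · simp
    rcases L.eq_empty_or_nonempty with rfl | hL0
    · simp
    rw [Subsingleton.eq_univ_of_nonempty hK0, Subsingleton.eq_univ_of_nonempty hL0,
      Subsingleton.eq_univ_of_nonempty (Set.univ_nonempty.add Set.univ_nonempty)]
    simp [volume_pi]
  | succ n ih =>
    let S : Set (Fin (n + 1) → ℝ) → ℝ → Set (Fin n → ℝ) := fun K s => {w | Fin.cons s w ∈ K}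
    have hcons : ∀ s : ℝ, Continuous fun w : Fin n → ℝ => (Fin.cons s w : Fin (n + 1) → ℝ) :=
      fun s => by fun_prop
    have hS : ∀ K, IsCompact K → ∀ s, IsCompact (S K s) := fun K hK s => by
      have : S K s ⊆ (fun x => Fin.tail x) '' K := fun w hw => ⟨_, hw, by simp⟩
      exact (hK.image (by unfold Fin.tail; fun_prop)).of_isClosed_subset
        (hK.isClosed.preimage (hcons s)) this
    have hvol : ∀ K, IsCompact K → Measurable (fun s => (volume (S K s)).toReal) ∧
        BddAbove (Set.range fun s => (volume (S K s)).toReal) ∧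
        volume K = ∫⁻ s, ENNReal.ofReal ((volume (S K s)).toReal) := by
      intro K hK
      have hmp := volume_preserving_piFinSuccAbove (fun _ : Fin (n + 1) => ℝ) 0
      have hm : MeasurableSet ((MeasurableEquiv.piFinSuccAbove (fun _ => ℝ) 0).symm ⁻¹' K) :=
        (MeasurableEquiv.measurable _) hK.measurableSet
      have hs : ∀ s, Prod.mk s ⁻¹' ((MeasurableEquiv.piFinSuccAbove (fun _ => ℝ) 0).symm ⁻¹' K)
          = S K s := fun s => by
        ext w
        simp [S, MeasurableEquiv.piFinSuccAbove, Fin.insertNthEquiv]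
      have hmeas := measurable_measure_prodMk_left (ν := (volume : Measure (Fin n → ℝ))) hm
      simp only [hs] at hmeas
      refine ⟨hmeas.ennreal_toReal, ?_, ?_⟩
      · refine ⟨(volume ((fun x => Fin.tail x) '' K)).toReal, ?_⟩
        rintro _ ⟨s, rfl⟩
        have hc : IsCompact ((fun x => Fin.tail x) '' K) :=
          hK.image (by unfold Fin.tail; fun_prop)
        exact ENNReal.toReal_mono hc.measure_lt_top.ne
          (measure_mono fun w hw => ⟨_, hw, by simp⟩)
      · rw [← hmp.symm.measure_preimage_equiv, Measure.volume_eq_prod, Measure.prod_apply hm]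
        refine lintegral_congr fun s => ?_
        rw [hs, ENNReal.ofReal_toReal (hS K hK s).measure_lt_top.ne]
    obtain ⟨hKm, hKb, hKv⟩ := hvol K hK
    obtain ⟨hLm, hLb, hLv⟩ := hvol L hL
    obtain ⟨hMm, -, hMv⟩ := hvol (K + L) (hK.add hL)
    have hpl := prekopa_leindler_real hKm hLm (hMm.div_const (2 ^ n))
      (fun _ => ENNReal.toReal_nonneg) (fun _ => ENNReal.toReal_nonneg)
      (fun _ => by positivity) hKb hLb (fun s s' => by
        have hsub : S K s + S L s' ⊆ S (K + L) (s + s') := by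
          rintro _ ⟨w, hw, w', hw', rfl⟩
          refine ⟨_, hw, _, hw', ?_⟩
          ext i
          refine Fin.cases ?_ (fun i => ?_) i <;> simp
        have h1 := (ih (hS K hK s) (hS L hL s')).trans
          (pow_le_pow_left₀ zero_le (measure_mono hsub) 2)
        have h2 := ENNReal.toReal_mono
          (ENNReal.pow_ne_top (hS _ (hK.add hL) (s + s')).measure_lt_top.ne) h1
        simp only [ENNReal.toReal_mul, ENNReal.toReal_pow] at h2
        rw [div_pow, le_div_iff₀ (by positivity), ← pow_mul, mul_comm n 2, pow_mul]
        norm_num at h2 ⊢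
        linarith)
    have hdiv : (∫⁻ s, ENNReal.ofReal ((volume (S (K + L) s)).toReal)) =
        2 ^ n * ∫⁻ s, ENNReal.ofReal ((volume (S (K + L) s)).toReal / 2 ^ n) := by
      rw [← lintegral_const_mul _ (hMm.div_const _).ennreal_ofReal]
      refine lintegral_congr fun s => ?_
      rw [ENNReal.ofReal_div_of_pos (by positivity), ENNReal.ofReal_pow (by norm_num)]
      simp only [ENNReal.ofReal_ofNat]
      rw [ENNReal.mul_div_cancel (by simp) (by simp)]
    rw [hKv, hLv, hMv, hdiv, mul_pow, pow_succ, ← pow_mul, mul_comm n 2, pow_mul, mul_assoc]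
    norm_num
    gcongr

open Matrix in
theorem Matrix.IsHermitian.dotProduct_mulVec_nonpos {κ : Type} [Fintype κ] [DecidableEq κ]
    {M : Matrix κ κ ℝ} (hM : M.IsHermitian) (z : κ → ℝ)
    (h1 : ∀ y, y ⬝ᵥ M *ᵥ y ≤ (M *ᵥ y) ⬝ᵥ (M *ᵥ y)) (h2 : ∀ y, y ⬝ᵥ M *ᵥ y ≤ y ⬝ᵥ y)
    (h3 : ∀ y, y ⬝ᵥ M *ᵥ y = y ⬝ᵥ y → ∃ r : ℝ, y = r • z) {y : κ → ℝ} (hy : y ⬝ᵥ z = 0) :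
    y ⬝ᵥ M *ᵥ y ≤ 0 := by
  have hv : ∀ k, (hM.eigenvectorBasis k : κ → ℝ) ⬝ᵥ hM.eigenvectorBasis k = 1 := fun k => by
    have := hM.eigenvectorBasis.inner_eq_one k
    rwa [EuclideanSpace.inner_eq_star_dotProduct] at this
  have hy' : y = ∑ k, (y ⬝ᵥ hM.eigenvectorBasis k) • (hM.eigenvectorBasis k : κ → ℝ) := by
    have := congrArg (WithLp.ofLp) (hM.eigenvectorBasis.sum_repr' (WithLp.toLp 2 y))
    simp only [EuclideanSpace.inner_eq_star_dotProduct, WithLp.ofLp_sum, WithLp.ofLp_smul] at this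
    exact this.symm
  have hMy : M *ᵥ y = ∑ k, (y ⬝ᵥ hM.eigenvectorBasis k) •
      (hM.eigenvalues k • (hM.eigenvectorBasis k : κ → ℝ)) := by
    conv_lhs => rw [hy']
    rw [Matrix.mulVec_sum]
    refine Finset.sum_congr rfl fun k _ => ?_
    rw [Matrix.mulVec_smul, hM.mulVec_eigenvectorBasis]
  rw [hMy, dotProduct_sum]
  refine Finset.sum_nonpos fun k _ => ?_
  rw [dotProduct_smul, dotProduct_smul, smul_eq_mul, smul_eq_mul]
  have e1 := h1 (hM.eigenvectorBasis k)
  have e2 := h2 (hM.eigenvectorBasis k)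
  have e3 := h3 (hM.eigenvectorBasis k)
  rw [hM.mulVec_eigenvectorBasis, dotProduct_smul, hv, smul_eq_mul, mul_one] at e1 e2 e3
  rw [dotProduct_smul, smul_dotProduct, hv, smul_eq_mul, smul_eq_mul, mul_one] at e1
  by_cases hl : hM.eigenvalues k ≤ 0
  · nlinarith [mul_self_nonneg (y ⬝ᵥ hM.eigenvectorBasis k)]
  · obtain ⟨r, hr⟩ := e3 (by nlinarith)
    rw [hr, dotProduct_smul, hy]
    simp

open Matrix in
/-- A symmetric matrix with nonnegative off-diagonal entries satisfying a Bochner type inequality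
is negative semidefinite on a hyperplane. -/
theorem Matrix.dotProduct_mulVec_nonpos_of_le_sum {κ : Type} [Fintype κ] [DecidableEq κ]
    {A : Matrix κ κ ℝ} (hA : A.IsSymm) {c b : κ → ℝ} (hc : ∀ i, 0 < c i) (hb : ∀ i, 0 < b i)
    (hcb : A *ᵥ c = b) (hoff : ∀ i j, i ≠ j → 0 ≤ A i j)
    (hirr : ∀ I : Set κ, I.Nonempty → Iᶜ.Nonempty → ∃ i ∈ I, ∃ j ∉ I, A i j ≠ 0)
    (hsq : ∀ x, x ⬝ᵥ A *ᵥ x ≤ ∑ i, c i / b i * (A *ᵥ x) i ^ 2) {x : κ → ℝ} (hx : x ⬝ᵥ b = 0) :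
    x ⬝ᵥ A *ᵥ x ≤ 0 := by
  set σ : κ → ℝ := fun i => √(b i / c i) with hσ
  have hσ0 : ∀ i, 0 < σ i := fun i => Real.sqrt_pos.2 (div_pos (hb i) (hc i))
  have hσ2 : ∀ i, σ i * σ i = b i / c i := fun i => Real.mul_self_sqrt (div_pos (hb i) (hc i)).le
  set M : Matrix κ κ ℝ := Matrix.of fun i j => A i j / (σ i * σ j) with hMdef
  have hM : M.IsHermitian := by
    ext i j
    simp [hMdef, hA.apply i j, mul_comm]
  have hMv : ∀ y i, (M *ᵥ y) i = (A *ᵥ fun i => y i / σ i) i / σ i := fun y i => by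
    simp only [mulVec, dotProduct, Finset.sum_div, hMdef, Matrix.of_apply]
    refine Finset.sum_congr rfl fun j _ => ?_
    have := (hσ0 i).ne'; have := (hσ0 j).ne'
    field_simp
  have hyM : ∀ y, y ⬝ᵥ M *ᵥ y = (fun i => y i / σ i) ⬝ᵥ A *ᵥ fun i => y i / σ i := fun y => by
    simp only [dotProduct, hMv]
    exact Finset.sum_congr rfl fun j _ => by ring
  have key : ∀ x : κ → ℝ, ∑ i, b i / c i * x i ^ 2 - x ⬝ᵥ A *ᵥ x =
      ∑ i, ∑ j, 2⁻¹ * (A i j * c i * c j * (x i / c i - x j / c j) ^ 2) := fun x => by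
    have e1 : ∑ i, b i / c i * x i ^ 2 = ∑ i, ∑ j, A i j * c j / c i * x i ^ 2 := by
      refine Finset.sum_congr rfl fun i _ => ?_
      rw [← hcb, ← Finset.sum_mul, ← Finset.sum_div]
      rfl
    have e2 : ∑ i, ∑ j, A i j * c j / c i * x i ^ 2 = ∑ i, ∑ j, A i j * c i / c j * x j ^ 2 := by
      rw [Finset.sum_comm]
      refine Finset.sum_congr rfl fun i _ => Finset.sum_congr rfl fun j _ => ?_
      rw [hA.apply i j]
    have e3 : x ⬝ᵥ A *ᵥ x = ∑ i, ∑ j, A i j * x i * x j := by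
      simp only [dotProduct, mulVec, Finset.mul_sum]
      exact Finset.sum_congr rfl fun i _ => Finset.sum_congr rfl fun j _ => by ring
    have e4 : ∑ i, b i / c i * x i ^ 2 = 2⁻¹ * ∑ i, ∑ j, A i j * c j / c i * x i ^ 2 +
        2⁻¹ * ∑ i, ∑ j, A i j * c i / c j * x j ^ 2 := by
      rw [← e2, ← e1]; ring
    rw [e4, e3]
    simp only [Finset.mul_sum, ← Finset.sum_add_distrib, ← Finset.sum_sub_distrib]
    refine Finset.sum_congr rfl fun i _ => Finset.sum_congr rfl fun j _ => ?_
    have := (hc i).ne'; have := (hc j).ne'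
    field_simp
    ring
  have hterm : ∀ (x : κ → ℝ) i j,
      0 ≤ 2⁻¹ * (A i j * c i * c j * (x i / c i - x j / c j) ^ 2) := fun x i j => by
    rcases eq_or_ne i j with rfl | h
    · simp
    · have := hoff i j h; have := hc i; have := hc j
      positivity
  have hyy : ∀ y : κ → ℝ, y ⬝ᵥ y = ∑ i, b i / c i * (y i / σ i) ^ 2 := fun y => by
    refine Finset.sum_congr rfl fun i _ => ?_
    rw [← hσ2]
    have := (hσ0 i).ne'
    field_simp
  have hyx : ((fun i => σ i * x i) ⬝ᵥ fun i => σ i * c i) = 0 := by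
    rw [← hx]
    refine Finset.sum_congr rfl fun i _ => ?_
    have := (hc i).ne'
    rw [mul_mul_mul_comm, hσ2]
    field_simp
  have hfin := hM.dotProduct_mulVec_nonpos (fun i => σ i * c i) (fun y => ?_) (fun y => ?_)
    (fun y hy => ?_) hyx
  · rw [hyM] at hfin
    have : (fun i => σ i * x i / σ i) = x := by
      ext i; have := (hσ0 i).ne'; field_simp
    rwa [this] at hfin
  · rw [hyM]
    refine (hsq _).trans (le_of_eq ?_)
    refine Finset.sum_congr rfl fun i _ => ?_
    rw [hMv, div_mul_div_comm, hσ2]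
    have := (hc i).ne'; have := (hb i).ne'
    field_simp
  · rw [hyM, hyy, ← sub_nonneg, key]
    exact Finset.sum_nonneg fun i _ => Finset.sum_nonneg fun j _ => hterm (fun i => y i / σ i) i j
  · rw [hyM, hyy] at hy
    have h0 := key (fun i => y i / σ i)
    have hterm' : ∀ i j, 0 ≤ 2⁻¹ * (A i j * c i * c j * (y i / σ i / c i - y j / σ j / c j) ^ 2) :=
      hterm fun i => y i / σ i
    rw [hy, sub_self, eq_comm,
      Finset.sum_eq_zero_iff_of_nonneg (fun i _ => Finset.sum_nonneg fun j _ => hterm' i j)] at h0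
    have h1 : ∀ i j, A i j ≠ 0 → y i / σ i / c i = y j / σ j / c j := fun i j hij => by
      have := (Finset.sum_eq_zero_iff_of_nonneg (fun j _ => hterm' i j)).1
        (h0 i (Finset.mem_univ _)) j (Finset.mem_univ _)
      have hci := (hc i).ne'; have hcj := (hc j).ne'
      simpa [hij, hci, hcj, sub_eq_zero] using this
    rcases isEmpty_or_nonempty κ with hk | ⟨⟨k⟩⟩
    · exact ⟨0, by ext i; exact hk.elim i⟩
    refine ⟨y k / σ k / c k, ?_⟩
    have hall : ∀ i, y i / σ i / c i = y k / σ k / c k := by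
      by_contra! hne
      obtain ⟨i, hi, j, hj, hij⟩ := hirr {i | y i / σ i / c i = y k / σ k / c k} ⟨k, rfl⟩ hne
      exact hj ((h1 i j hij).symm.trans hi)
    ext i
    rw [Pi.smul_apply, ← hall i, smul_eq_mul]
    have := (hσ0 i).ne'; have := (hc i).ne'
    field_simp

/-- Reverse Cauchy–Schwarz inequality for a symmetric bilinear form that is negative semidefinite on
the orthogonal complement of `z`. -/
theorem LinearMap.mul_le_sq_of_nonpos_of_orthogonal {E : Type} [AddCommGroup E] [Module ℝ E]
    (B : E →ₗ[ℝ] E →ₗ[ℝ] ℝ) (hB : ∀ x y, B x y = B y x) {y z : E}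
    (hz : ∀ x, B x z = 0 → B x x ≤ 0) (hyz : 0 < B y z) (hyy : 0 < B y y) (x : E) :
    B x x * B y y ≤ B x y ^ 2 := by
  have h := hz (B y z • x - B x z • y) (by simp; ring)
  simp only [map_sub, map_smul, LinearMap.sub_apply, LinearMap.smul_apply, smul_eq_mul] at h
  rw [hB y x] at h
  by_contra! hlt
  have h1 : 0 < B y z ^ 2 * (B x x * B y y - B x y ^ 2) := mul_pos (by positivity) (by linarith)
  have h2 := mul_le_mul_of_nonneg_left h hyy.le
  nlinarith [sq_nonneg (B y y * B x z - B y z * B x y)]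

theorem HasDerivAt.of_add_smul {E : Type} [AddCommGroup E] [Module ℝ E] {F : E → ℝ} {x y : E}
    {r g : ℝ} (h : HasDerivAt (fun s : ℝ => F (x + r • y + s • y)) g 0) :
    HasDerivAt (fun s : ℝ => F (x + s • y)) g r := by
  have h2 : HasDerivAt (fun s : ℝ => s - r) 1 r := (hasDerivAt_id r).sub_const r
  have h3 : HasDerivAt (fun s : ℝ => F (x + r • y + s • y)) g (r - r) := by rwa [sub_self]
  have := HasDerivAt.comp (h₂ := fun s : ℝ => F (x + r • y + s • y)) (h := fun s : ℝ => s - r)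
    r h3 h2
  rw [mul_one] at this
  refine this.congr_of_eventuallyEq (.of_forall fun s => ?_)
  simp only [Function.comp]
  congr 1
  module

theorem hasDerivAt_line_add {E : Type} [NormedAddCommGroup E] [NormedSpace ℝ E] {F g h : E → ℝ}
    {U : Set E} (hU : IsOpen U) {y z : E} (hg : ContinuousOn g U) (hh : ContinuousOn h U)
    (hy : ∀ t ∈ U, HasDerivAt (fun r : ℝ => F (t + r • y)) (g t) 0)
    (hz : ∀ t ∈ U, HasDerivAt (fun r : ℝ => F (t + r • z)) (h t) 0) {t : E} (ht : t ∈ U) :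
    HasDerivAt (fun r : ℝ => F (t + r • (y + z))) (g t + h t) 0 := by
  have hcont : Continuous fun v : ℝ × ℝ => t + v.1 • y + v.2 • z := by fun_prop
  have hev : ∀ᶠ v : ℝ × ℝ in nhds (0, 0), t + v.1 • y + v.2 • z ∈ U :=
    hcont.continuousAt.eventually_mem (by simpa using hU.mem_nhds ht)
  have key := hasStrictFDerivAt_uncurry_coprod (𝕜 := ℝ) (u := ((0, 0) : ℝ × ℝ))
    (f := fun a b => F (t + a • y + b • z))
    (f₁ := fun a b => ContinuousLinearMap.toSpanSingleton ℝ (g (t + a • y + b • z)))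
    (f₂ := fun a b => ContinuousLinearMap.toSpanSingleton ℝ (h (t + a • y + b • z)))
    (by
      filter_upwards [hev] with v hv
      have := hy _ hv
      refine HasDerivAt.hasFDerivAt ?_
      have e : ∀ a : ℝ, t + a • y + v.2 • z = t + v.2 • z + a • y := fun a => by abel
      simp only [e] at this ⊢
      exact HasDerivAt.of_add_smul this)
    (by
      filter_upwards [hev] with v hv
      have := hz _ hv
      refine HasDerivAt.hasFDerivAt ?_
      exact HasDerivAt.of_add_smul this)
    (by
      have hg' : ContinuousAt g (t + (0 : ℝ) • y + (0 : ℝ) • z) := by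
        simpa using hg.continuousAt (hU.mem_nhds ht)
      have h1 : ContinuousAt (fun v : ℝ × ℝ => g (t + v.1 • y + v.2 • z)) (0, 0) :=
        ContinuousAt.comp (f := fun v : ℝ × ℝ => t + v.1 • y + v.2 • z) (x := ((0, 0) : ℝ × ℝ))
          hg' hcont.continuousAt
      exact (ContinuousLinearMap.toSpanSingletonCLE (𝕜 := ℝ) (E := ℝ)).continuous.continuousAt.comp
        h1)
    (by
      have hg' : ContinuousAt h (t + (0 : ℝ) • y + (0 : ℝ) • z) := by
        simpa using hh.continuousAt (hU.mem_nhds ht)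
      have h1 : ContinuousAt (fun v : ℝ × ℝ => h (t + v.1 • y + v.2 • z)) (0, 0) :=
        ContinuousAt.comp (f := fun v : ℝ × ℝ => t + v.1 • y + v.2 • z) (x := ((0, 0) : ℝ × ℝ))
          hg' hcont.continuousAt
      exact (ContinuousLinearMap.toSpanSingletonCLE (𝕜 := ℝ) (E := ℝ)).continuous.continuousAt.comp
        h1)
  have hd : HasDerivAt (fun r : ℝ => (r, r)) ((1 : ℝ), (1 : ℝ)) 0 :=
    (hasDerivAt_id 0).prodMk (hasDerivAt_id 0)
  have := HasFDerivAt.comp_hasDerivAt (f := fun r : ℝ => (r, r)) (0 : ℝ) key.hasFDerivAt hd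
  refine (this.congr_deriv ?_).congr_of_eventuallyEq (.of_forall fun r => ?_)
  · simp [Function.HasUncurry.uncurry]
  · simp [Function.HasUncurry.uncurry, add_assoc]

theorem hasDerivAt_line_sum {E ι : Type} [NormedAddCommGroup E] [NormedSpace ℝ E] {F : E → ℝ}
    {U : Set E} (hU : IsOpen U) {g : ι → E → ℝ} {e : ι → E} (J : Finset ι)
    (hg : ∀ j ∈ J, ContinuousOn (g j) U)
    (h : ∀ j ∈ J, ∀ t ∈ U, HasDerivAt (fun r : ℝ => F (t + r • e j)) (g j t) 0) (a : ι → ℝ) {t : E}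
    (ht : t ∈ U) :
    HasDerivAt (fun r : ℝ => F (t + r • ∑ j ∈ J, a j • e j)) (∑ j ∈ J, a j * g j t) 0 := by
  classical
  induction J using Finset.induction_on generalizing t with
  | empty => simpa using hasDerivAt_const (0 : ℝ) (F t)
  | insert i J hi ih =>
    simp only [Finset.forall_mem_insert] at hg h
    rw [Finset.sum_insert hi, Finset.sum_insert hi]
    refine hasDerivAt_line_add (g := fun t => a i * g i t) hU (continuousOn_const.mul hg.1)
      (h := fun t => ∑ j ∈ J, a j * g j t)
      (continuousOn_finsetSum _ fun j hj => continuousOn_const.mul (hg.2 j hj)) ?_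
      (fun t ht => ih hg.2 h.2 ht) ht
    intro t ht
    have h1 : HasDerivAt (fun r : ℝ => r * a i) (a i) 0 := by
      simpa using (hasDerivAt_id (0 : ℝ)).mul_const (a i)
    have h2 : HasDerivAt (fun r : ℝ => F (t + r • e i)) (g i t) (0 * a i) := by
      simpa using h.1 t ht
    have := h2.comp (0 : ℝ) h1
    rw [mul_comm]
    simpa [Function.comp_def, smul_smul] using this

/-- A function whose increments in the direction `e` are integrals of a continuous function `g` has
derivative `g` in that direction. -/
theorem hasDerivAt_line_of_integral {E : Type} [NormedAddCommGroup E] [NormedSpace ℝ E]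
    {F g : E → ℝ} {U : Set E} (hU : IsOpen U) (hg : Continuous g) {e : E}
    (h : ∀ t, ∀ ε ≥ 0, (∀ r ∈ Set.Icc 0 ε, t + r • e ∈ U) →
      F (t + ε • e) - F t = ∫ r in (0 : ℝ)..ε, g (t + r • e)) {t : E} (ht : t ∈ U) :
    HasDerivAt (fun r : ℝ => F (t + r • e)) (g t) 0 := by
  have hcont : Continuous fun r : ℝ => t + r • e := by fun_prop
  have hev : ∀ᶠ r : ℝ in nhds 0, t + r • e ∈ U :=
    hcont.continuousAt.eventually_mem (by simpa using hU.mem_nhds ht)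
  obtain ⟨δ, hδ, hδ'⟩ := Metric.eventually_nhds_iff_ball.1 hev
  have hG : Continuous fun r : ℝ => g (t + r • e) := hg.comp hcont
  have hd := (intervalIntegral.integral_hasDerivAt_right (hG.intervalIntegrable 0 0)
    (hG.stronglyMeasurableAtFilter _ _) hG.continuousAt).const_add (F t)
  simp only [zero_smul, add_zero] at hd
  refine hd.congr_of_eventuallyEq ?_
  filter_upwards [Metric.ball_mem_nhds (0 : ℝ) hδ] with r hr
  rw [Real.ball_eq_Ioo] at hr hδ'
  rcases le_total 0 r with h0 | h0
  · have := h t r h0 fun s hs => hδ' s ⟨by linarith [hs.1], by linarith [hs.2, hr.2]⟩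
    linarith
  · have := h (t + r • e) (-r) (by linarith) fun s hs => by
      rw [add_assoc, ← add_smul]
      exact hδ' _ ⟨by linarith [hs.1, hr.1], by linarith [hs.2, hr.2]⟩
    have e1 : t + r • e + -r • e = t := by module
    have e2 : ∫ s in (0 : ℝ)..-r, g (t + r • e + s • e) = ∫ s in r..0, g (t + s • e) := by
      have := intervalIntegral.integral_comp_add_left (fun s => g (t + s • e)) r (a := 0) (b := -r)
      simp only [add_zero, add_neg_cancel] at this
      rw [← this]
      refine intervalIntegral.integral_congr fun s _ => ?_
      simp only [add_smul, add_assoc]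
    rw [e1, e2, intervalIntegral.integral_symm] at this
    linarith

/-- Disintegration of Lebesgue measure along the level sets of a nonzero linear functional. -/
theorem exists_continuousLinearEquiv_slice {n : ℕ} {u : (Fin (n + 1) → ℝ) →ₗ[ℝ] ℝ} (hu : u ≠ 0) :
    ∃ (φ : ((Fin n → ℝ) × ℝ) ≃L[ℝ] (Fin (n + 1) → ℝ)) (c : ℝ), 0 < c ∧ (∀ w s, u (φ (w, s)) = s) ∧
      ∀ A : Set (Fin (n + 1) → ℝ), MeasurableSet A →
        volume A = ENNReal.ofReal c * ∫⁻ s, volume {w | φ (w, s) ∈ A} := by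
  obtain ⟨v, hv⟩ : ∃ v, u v = 1 := LinearMap.surjective hu 1
  have hk : Module.finrank ℝ (Fin n → ℝ) = Module.finrank ℝ (LinearMap.ker u) := by
    have h1 := u.finrank_range_add_finrank_ker
    rw [LinearMap.range_eq_top.2 (LinearMap.surjective hu), finrank_top] at h1
    simp at h1 ⊢
    omega
  obtain ⟨e⟩ := FiniteDimensional.nonempty_linearEquiv_of_finrank_eq hk
  have hue : ∀ w, u (e w : Fin (n + 1) → ℝ) = 0 := fun w => (e w).2
  let φ₀ : ((Fin n → ℝ) × ℝ) →ₗ[ℝ] (Fin (n + 1) → ℝ) :=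
    LinearMap.coprod ((LinearMap.ker u).subtype ∘ₗ e.toLinearMap) (LinearMap.toSpanSingleton ℝ _ v)
  have hφ₀ : ∀ w s, φ₀ (w, s) = (e w : Fin (n + 1) → ℝ) + s • v := fun w s => by
    simp [φ₀]
  have huφ : ∀ w s, u (φ₀ (w, s)) = s := fun w s => by
    rw [hφ₀, map_add, map_smul, hue, hv]
    simp
  have hinj : Function.Injective φ₀ := by
    rintro ⟨w, s⟩ ⟨w', s'⟩ h
    have hs : s = s' := by rw [← huφ w s, h, huφ]
    subst hs
    rw [hφ₀, hφ₀, add_left_inj] at h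
    rw [e.injective (Subtype.ext h)]
  let φ : ((Fin n → ℝ) × ℝ) ≃L[ℝ] (Fin (n + 1) → ℝ) :=
    (LinearEquiv.ofInjectiveOfFinrankEq φ₀ hinj (by simp)).toContinuousLinearEquiv
  have hφ : ∀ x, φ x = φ₀ x := fun x => rfl
  let μ : Measure (Fin (n + 1) → ℝ) := Measure.map φ volume
  have hprod : (volume : Measure ((Fin n → ℝ) × ℝ)).IsAddHaarMeasure :=
    Measure.prod.instIsAddHaarMeasure volume volume
  have hμ : μ.IsAddHaarMeasure := ContinuousLinearEquiv.isAddHaarMeasure_map φ volume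
  have hvol := Measure.isAddLeftInvariant_eq_smul (volume : Measure (Fin (n + 1) → ℝ)) μ
  have hpos := Measure.addHaarScalarFactor_pos_of_isAddHaarMeasure
    (volume : Measure (Fin (n + 1) → ℝ)) μ
  refine ⟨φ, Measure.addHaarScalarFactor (volume : Measure (Fin (n + 1) → ℝ)) μ, hpos, huφ,
    fun A hA => ?_⟩
  have hm : MeasurableSet (φ ⁻¹' A) := φ.continuous.measurable hA
  conv_lhs => rw [hvol]
  rw [Measure.smul_apply, Measure.map_apply φ.continuous.measurable hA, Measure.volume_eq_prod,
    Measure.prod_apply_symm hm, ENNReal.ofReal_coe_nnreal]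
  rfl

/-- A nonempty open convex cone. -/
structure IsOpenCone {E : Type} [NormedAddCommGroup E] [NormedSpace ℝ E] (C : Set E) : Prop where
  isOpen : IsOpen C
  nonempty : C.Nonempty
  add_mem : ∀ t ∈ C, ∀ s ∈ C, t + s ∈ C
  smul_mem : ∀ r : ℝ, 0 < r → ∀ t ∈ C, r • t ∈ C

theorem IsOpenCone.exists_forall_add_smul_mem {E : Type} [NormedAddCommGroup E] [NormedSpace ℝ E]
    {C : Set E} (hC : IsOpenCone C) {t : E} (ht : t ∈ C) (v : E) :
    ∃ δ > 0, ∀ r : ℝ, |r| < δ → t + r • v ∈ C := by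
  have hcont : Continuous fun r : ℝ => t + r • v := by fun_prop
  have hev : ∀ᶠ r : ℝ in nhds 0, t + r • v ∈ C :=
    hcont.continuousAt.eventually_mem (by simpa using hC.isOpen.mem_nhds ht)
  obtain ⟨δ, hδ, h⟩ := Metric.eventually_nhds_iff_ball.1 hev
  exact ⟨δ, hδ, fun r hr => h r (by simpa using hr)⟩

/-- The polyhedron cut out by the inequalities `u j x ≤ τ j t` for `j ∈ J`. -/
def polyhedron {ι E : Type} [AddCommGroup E] [Module ℝ E] (J : Finset ι) (u : ι → E →ₗ[ℝ] ℝ)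
    (τ : ι → (ι → ℝ) →ₗ[ℝ] ℝ) (t : ι → ℝ) : Set E :=
  {x | ∀ j ∈ J, u j x ≤ τ j t}

/-- A family of polytopes, parametrized by an open cone of right-hand sides, that is additive
under Minkowski sums. -/
structure IsAdditiveSystem {ι E : Type} [DecidableEq ι] [AddCommGroup E] [Module ℝ E]
    [TopologicalSpace E] (C : Set (ι → ℝ)) (J : Finset ι) (u : ι → E →ₗ[ℝ] ℝ)
    (τ : ι → (ι → ℝ) →ₗ[ℝ] ℝ) : Prop where
  apply_single : ∀ j ∈ J, ∀ k ∈ J, τ j (Pi.single k 1) = if j = k then 1 else 0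
  nonempty : ∀ t ∈ C, (polyhedron J u τ t).Nonempty
  isCompact : ∀ t ∈ C, IsCompact (polyhedron J u τ t)
  subset_add : ∀ t ∈ C, ∀ s ∈ C,
    polyhedron J u τ (t + s) ⊆ polyhedron J u τ t + polyhedron J u τ s

section

variable {ι E : Type} [AddCommGroup E] [Module ℝ E] {J : Finset ι} {u : ι → E →ₗ[ℝ] ℝ}
  {τ : ι → (ι → ℝ) →ₗ[ℝ] ℝ}

theorem smul_mem_polyhedron {t : ι → ℝ} {x : E} (hx : x ∈ polyhedron J u τ t) {r : ℝ}
    (hr : 0 ≤ r) : r • x ∈ polyhedron J u τ (r • t) := fun j hj => by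
  rw [map_smul, map_smul]
  exact mul_le_mul_of_nonneg_left (hx j hj) hr

theorem add_mem_polyhedron {t s : ι → ℝ} {x y : E} (hx : x ∈ polyhedron J u τ t)
    (hy : y ∈ polyhedron J u τ s) : x + y ∈ polyhedron J u τ (t + s) := fun j hj => by
  rw [map_add, map_add]
  exact add_le_add (hx j hj) (hy j hj)

theorem convex_polyhedron (t : ι → ℝ) : Convex ℝ (polyhedron J u τ t) := by
  intro x hx y hy a b ha hb hab
  have := add_mem_polyhedron (smul_mem_polyhedron hx ha) (smul_mem_polyhedron hy hb)
  rwa [← add_smul, hab, one_smul] at this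

/-- The `i`-th inequality is attained on the polyhedron. -/
def IsTight (J : Finset ι) (u : ι → E →ₗ[ℝ] ℝ) (τ : ι → (ι → ℝ) →ₗ[ℝ] ℝ) (i : ι) (t : ι → ℝ) :
    Prop :=
  ∃ x ∈ polyhedron J u τ t, u i x = τ i t

variable [DecidableEq ι] [TopologicalSpace E] {C : Set (ι → ℝ)}

theorem IsAdditiveSystem.apply_add_single (h : IsAdditiveSystem C J u τ) {i j : ι} (hi : i ∈ J)
    (hj : j ∈ J) (t : ι → ℝ) (ε : ℝ) :
    τ j (t + ε • Pi.single i 1) = τ j t + if j = i then ε else 0 := by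
  rw [map_add, map_smul, h.apply_single j hj i hi]
  simp

theorem IsAdditiveSystem.polyhedron_add_single_eq (h : IsAdditiveSystem C J u τ) {i : ι}
    (hi : i ∈ J) {t : ι → ℝ} (ht : t ∈ C) (hti : ¬ IsTight J u τ i t) {ε : ℝ} (hε : 0 ≤ ε) :
    polyhedron J u τ (t + ε • Pi.single i 1) = polyhedron J u τ t := by
  have hmono : polyhedron J u τ t ⊆ polyhedron J u τ (t + ε • Pi.single i 1) := fun x hx j hj => by
    rw [h.apply_add_single hi hj]
    have := hx j hj
    split_ifs <;> linarith
  refine Set.Subset.antisymm (fun x hx => ?_) hmono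
  by_contra hxt
  have hxj : ∀ j ∈ J, j ≠ i → u j x ≤ τ j t := fun j hj hji => by
    have := hx j hj
    rwa [h.apply_add_single hi hj, if_neg hji, add_zero] at this
  have hxi : τ i t < u i x := by
    by_contra! hle
    refine hxt fun j hj => ?_
    by_cases hji : j = i
    · exact hji ▸ hle
    · exact hxj j hj hji
  obtain ⟨y, hy⟩ := h.nonempty t ht
  have hyi : u i y < τ i t := lt_of_le_of_ne (hy i hi) fun hne => hti ⟨y, hy, hne⟩
  have hden : 0 < u i x - u i y := by linarith
  set a := (τ i t - u i y) / (u i x - u i y) with ha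
  have ha0 : 0 ≤ a := div_nonneg (by linarith) hden.le
  have ha1 : a ≤ 1 := (div_le_one hden).2 (by linarith)
  have hai : a * (u i x - u i y) = τ i t - u i y := div_mul_cancel₀ _ hden.ne'
  have hui : u i (a • x + (1 - a) • y) = τ i t := by
    simp only [map_add, map_smul, smul_eq_mul]
    linarith
  refine hti ⟨a • x + (1 - a) • y, fun j hj => ?_, hui⟩
  by_cases hji : j = i
  · rw [hji, hui]
  · have h1 := mul_le_mul_of_nonneg_left (hxj j hj hji) ha0
    have h2 := mul_le_mul_of_nonneg_left (hy j hj) (sub_nonneg.2 ha1)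
    simp only [map_add, map_smul, smul_eq_mul]
    linarith

variable [Fintype ι]

theorem IsAdditiveSystem.isTight (h : IsAdditiveSystem C J u τ) (hC : IsOpenCone C) {i : ι}
    (hi : i ∈ J) {t s : ι → ℝ} (ht : t ∈ C) (hs : s ∈ C) (hti : IsTight J u τ i t) :
    IsTight J u τ i s := by
  obtain ⟨δ, hδ, hmem⟩ := hC.exists_forall_add_smul_mem ht (-s)
  obtain ⟨x, hx, hxi⟩ := hti
  have h1 : t + (δ / 2) • -s ∈ C := hmem _ (by rw [abs_of_pos] <;> linarith)
  have h2 : (δ / 2) • s ∈ C := hC.smul_mem _ (by linarith) _ hs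
  have e : t + (δ / 2) • -s + (δ / 2) • s = t := by module
  obtain ⟨y, hy, z, hz, rfl⟩ := h.subset_add _ h1 _ h2 (by rwa [e])
  refine ⟨(δ / 2)⁻¹ • z, ?_, ?_⟩
  · have := smul_mem_polyhedron hz (r := (δ / 2)⁻¹) (by positivity)
    rwa [inv_smul_smul₀ (by positivity)] at this
  · have a1 := hy i hi
    have a2 := hz i hi
    rw [← e, map_add, map_add] at hxi
    have : u i z = δ / 2 * τ i s := by
      rw [map_smul, smul_eq_mul] at a2 hxi
      linarith
    rw [map_smul, this, smul_eq_mul, inv_mul_cancel_left₀ (by positivity)]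

end

theorem IsAdditiveSystem.exists_facet {ι : Type} [Fintype ι] [DecidableEq ι] {n : ℕ}
    {C : Set (ι → ℝ)} {J : Finset ι} {u : ι → (Fin (n + 1) → ℝ) →ₗ[ℝ] ℝ}
    {τ : ι → (ι → ℝ) →ₗ[ℝ] ℝ} (h : IsAdditiveSystem C J u τ) {i : ι} (hi : i ∈ J)
    (ht : ∀ t ∈ C, IsTight J u τ i t) (hu : u i ≠ 0) :
    ∃ (c : ℝ) (u' : ι → (Fin n → ℝ) →ₗ[ℝ] ℝ) (τ' : ι → (ι → ℝ) →ₗ[ℝ] ℝ), 0 < c ∧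
      IsAdditiveSystem C (J.erase i) u' τ' ∧
      ∀ g : (ι → ℝ) → ℝ, Continuous g →
        (∀ t ∈ C, (volume (polyhedron (J.erase i) u' τ' t)).toReal = g t) →
        ∀ t, ∀ ε ≥ 0, (∀ r ∈ Set.Icc 0 ε, t + r • (Pi.single i 1 : ι → ℝ) ∈ C) →
          (volume (polyhedron J u τ (t + ε • Pi.single i 1))).toReal -
            (volume (polyhedron J u τ t)).toReal =
              ∫ r in (0 : ℝ)..ε, c * g (t + r • Pi.single i 1) := by
  obtain ⟨φ, c, hc, hφ, hvol⟩ := exists_continuousLinearEquiv_slice hu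
  let u' : ι → (Fin n → ℝ) →ₗ[ℝ] ℝ := fun j =>
    u j ∘ₗ (φ : ((Fin n → ℝ) × ℝ) →ₗ[ℝ] (Fin (n + 1) → ℝ)) ∘ₗ LinearMap.inl ℝ _ _
  let τ' : ι → (ι → ℝ) →ₗ[ℝ] ℝ := fun j => τ j + (-u j (φ (0, 1))) • τ i
  have hu' : ∀ j w, u' j w = u j (φ (w, 0)) := fun j w => rfl
  have hτ' : ∀ j t, τ' j t = τ j t - u j (φ (0, 1)) * τ i t := fun j t => by
    simp [τ']; ring
  have hφs : ∀ j w s, u j (φ (w, s)) = u' j w + s * u j (φ (0, 1)) := fun j w s => by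
    have : ((w, s) : (Fin n → ℝ) × ℝ) = (w, 0) + s • (0, 1) := by simp
    rw [this, map_add, map_add, map_smul, map_smul, hu', smul_eq_mul]
  have hmem : ∀ t w, φ (w, τ i t) ∈ polyhedron J u τ t ↔
      w ∈ polyhedron (J.erase i) u' τ' t := fun t w => by
    constructor
    · intro hw j hj
      have := hw j (Finset.mem_of_mem_erase hj)
      rw [hφs] at this
      rw [hτ']
      linarith
    · intro hw j hj
      by_cases hji : j = i
      · rw [hji, hφ]
      · have := hw j (Finset.mem_erase.2 ⟨hji, hj⟩)
        rw [hτ'] at this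
        rw [hφs]
        linarith
  have hrep : ∀ x, ∃ w, x = φ (w, u i x) := fun x => by
    obtain ⟨⟨w, s⟩, rfl⟩ := φ.surjective x
    exact ⟨w, by rw [hφ]⟩
  have hsys : IsAdditiveSystem C (J.erase i) u' τ' := by
    refine ⟨fun j hj k hk => ?_, fun t htC => ?_, fun t htC => ?_, fun t htC s hsC => ?_⟩
    · rw [Finset.mem_erase] at hj hk
      rw [hτ', h.apply_single j hj.2 k hk.2, h.apply_single i hi k hk.2, if_neg hk.1.symm]
      simp
    · obtain ⟨x, hx, hxi⟩ := ht t htC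
      obtain ⟨w, hw⟩ := hrep x
      exact ⟨w, (hmem t w).1 (by rw [← hxi, ← hw]; exact hx)⟩
    · have : polyhedron (J.erase i) u' τ' t =
          Prod.fst '' (φ.toHomeomorph ⁻¹' polyhedron J u τ t ∩ Prod.snd ⁻¹' {τ i t}) := by
        ext w
        rw [← hmem]
        constructor
        · exact fun hw => ⟨(w, τ i t), ⟨hw, rfl⟩, rfl⟩
        · rintro ⟨⟨w, s⟩, ⟨hw, rfl⟩, rfl⟩
          exact hw
      rw [this]
      exact ((φ.toHomeomorph.isCompact_preimage.2 (h.isCompact t htC)).inter_right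
        (isClosed_singleton.preimage continuous_snd)).image continuous_fst
    · intro w hw
      obtain ⟨x, hx, y, hy, hxy⟩ := h.subset_add t htC s hsC ((hmem _ w).2 hw)
      have hxi := hx i hi
      have hyi := hy i hi
      have hsum := congrArg (u i) hxy
      simp only [map_add, hφ] at hsum
      obtain ⟨w₁, hw₁⟩ := hrep x
      obtain ⟨w₂, hw₂⟩ := hrep y
      rw [show u i x = τ i t by linarith] at hw₁
      rw [show u i y = τ i s by linarith] at hw₂
      refine ⟨w₁, (hmem t w₁).1 (hw₁ ▸ hx), w₂, (hmem s w₂).1 (hw₂ ▸ hy), ?_⟩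
      have : φ (w₁ + w₂, τ i t + τ i s) = φ (w, τ i t + τ i s) := by
        rw [map_add] at hxy
        rw [← hxy, hw₁, hw₂]
        exact map_add φ (w₁, τ i t) (w₂, τ i s)
      exact congrArg Prod.fst (φ.injective this)
  refine ⟨c, u', τ', hc, hsys, fun g hg hgC t ε hε hseg => ?_⟩
  have htC : t ∈ C := by simpa using hseg 0 ⟨le_rfl, hε⟩
  have htε := hseg ε ⟨hε, le_rfl⟩
  set e : ι → ℝ := Pi.single i 1 with he
  have hmono : polyhedron J u τ t ⊆ polyhedron J u τ (t + ε • e) := fun x hx j hj => by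
    rw [h.apply_add_single hi hj]
    have := hx j hj
    split_ifs <;> linarith
  have hslice : ∀ s, volume {w | φ (w, s) ∈ polyhedron J u τ (t + ε • e) \ polyhedron J u τ t} =
      (Set.Ioc (τ i t) (τ i t + ε)).indicator
        (fun s => ENNReal.ofReal (g (t + (s - τ i t) • e))) s := fun s => by
    by_cases hs : s ∈ Set.Ioc (τ i t) (τ i t + ε)
    · rw [Set.indicator_of_mem hs, ← hgC _ (hseg _ ⟨by linarith [hs.1], by linarith [hs.2]⟩),
        ENNReal.ofReal_toReal (hsys.isCompact _
          (hseg _ ⟨by linarith [hs.1], by linarith [hs.2]⟩)).measure_lt_top.ne]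
      congr 1
      ext w
      have hτs : τ i (t + (s - τ i t) • e) = s := by
        rw [h.apply_add_single hi hi, if_pos rfl]; ring
      rw [← hmem, hτs]
      constructor
      · intro hw j hj
        rw [h.apply_add_single hi hj]
        by_cases hji : j = i
        · rw [if_pos hji, hji, hφ]; linarith
        · have := hw.1 j hj
          rw [h.apply_add_single hi hj, if_neg hji] at this
          rwa [if_neg hji]
      · intro hw
        refine ⟨fun j hj => ?_, fun hw' => ?_⟩
        · have := hw j hj
          rw [h.apply_add_single hi hj] at this ⊢
          split_ifs at this ⊢
          · linarith [hs.2]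
          · exact this
        · have := hw' i hi
          rw [hφ] at this
          linarith [hs.1]
    · rw [Set.indicator_of_notMem hs]
      convert measure_empty (μ := (volume : Measure (Fin n → ℝ)))
      refine Set.eq_empty_of_forall_notMem fun w hw => hs ⟨?_, ?_⟩
      · by_contra! hle
        refine hw.2 fun j hj => ?_
        by_cases hji : j = i
        · rw [hji, hφ]; exact hle
        · have := hw.1 j hj
          rwa [h.apply_add_single hi hj, if_neg hji, add_zero] at this
      · have := hw.1 i hi
        rwa [h.apply_add_single hi hi, if_pos rfl, hφ] at this
  have hcont : Continuous fun s => g (t + (s - τ i t) • e) := hg.comp (by fun_prop)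
  have hdiff : volume (polyhedron J u τ (t + ε • e) \ polyhedron J u τ t) =
      ENNReal.ofReal (∫ r in (0 : ℝ)..ε, c * g (t + r • e)) := by
    rw [hvol _ ((h.isCompact _ htε).measurableSet.diff (h.isCompact _ htC).measurableSet)]
    simp_rw [hslice]
    rw [lintegral_indicator measurableSet_Ioc, ← ofReal_integral_eq_lintegral_ofReal,
      ← ENNReal.ofReal_mul hc.le, ← integral_const_mul,
      ← intervalIntegral.integral_of_le (by linarith)]
    · have := intervalIntegral.integral_comp_sub_right (fun r => c * g (t + r • e)) (τ i t)
        (a := τ i t) (b := τ i t + ε)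
      simp only [sub_self, add_sub_cancel_left] at this
      rw [this]
    · exact (hcont.integrableOn_Icc).mono_set Set.Ioc_subset_Icc_self
    · filter_upwards [ae_restrict_mem measurableSet_Ioc] with s hs
      have := hgC _ (hseg (s - τ i t) ⟨by linarith [hs.1], by linarith [hs.2]⟩)
      rw [← this]
      exact ENNReal.toReal_nonneg
  have hnn : 0 ≤ ∫ r in (0 : ℝ)..ε, c * g (t + r • e) := by
    refine intervalIntegral.integral_nonneg hε fun r hr => ?_
    rw [← hgC _ (hseg r hr)]
    positivity
  have hadd := measure_sdiff_add_inter (μ := volume) (polyhedron J u τ (t + ε • e))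
    (h.isCompact _ htC).measurableSet
  rw [Set.inter_eq_self_of_subset_right hmono, hdiff] at hadd
  rw [← hadd, ENNReal.toReal_add ENNReal.ofReal_ne_top (h.isCompact _ htC).measure_lt_top.ne,
    ENNReal.toReal_ofReal hnn]
  ring

/-- A linear functional as a homogeneous polynomial of degree one. -/
noncomputable def LinearMap.toMvPolynomialReal {ι : Type} [Fintype ι] [DecidableEq ι]
    (L : (ι → ℝ) →ₗ[ℝ] ℝ) : MvPolynomial ι ℝ :=
  ∑ i, MvPolynomial.C (L (Pi.single i 1)) * MvPolynomial.X i

section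

variable {ι : Type} [Fintype ι] [DecidableEq ι]

theorem LinearMap.eval_toMvPolynomialReal (L : (ι → ℝ) →ₗ[ℝ] ℝ) (t : ι → ℝ) :
    MvPolynomial.eval t L.toMvPolynomialReal = L t := by
  conv_rhs => rw [pi_eq_sum_univ' t]
  simp [toMvPolynomialReal, mul_comm]

theorem LinearMap.isHomogeneous_toMvPolynomialReal (L : (ι → ℝ) →ₗ[ℝ] ℝ) :
    L.toMvPolynomialReal.IsHomogeneous 1 :=
  MvPolynomial.IsHomogeneous.sum _ _ _ fun i _ => (MvPolynomial.isHomogeneous_X _ i).C_mul _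

variable {n : ℕ} {C : Set (ι → ℝ)} {J : Finset ι} {u : ι → (Fin n → ℝ) →ₗ[ℝ] ℝ}
  {τ : ι → (ι → ℝ) →ₗ[ℝ] ℝ}

omit [Fintype ι] [DecidableEq ι] in
theorem polyhedron_smul {r : ℝ} (hr : 0 < r) (t : ι → ℝ) :
    polyhedron J u τ (r • t) = r • polyhedron J u τ t := by
  refine Set.Subset.antisymm (fun x hx => ?_) ?_
  · rw [Set.mem_smul_set_iff_inv_smul_mem₀ hr.ne']
    have := smul_mem_polyhedron hx (inv_nonneg.2 hr.le)
    rwa [inv_smul_smul₀ hr.ne'] at this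
  · rintro _ ⟨x, hx, rfl⟩
    exact smul_mem_polyhedron hx hr.le

omit [Fintype ι] [DecidableEq ι] in
theorem toReal_volume_polyhedron_smul {r : ℝ} (hr : 0 < r) (t : ι → ℝ) :
    (volume (polyhedron J u τ (r • t))).toReal = r ^ n * (volume (polyhedron J u τ t)).toReal := by
  rw [polyhedron_smul hr, Measure.addHaar_smul, ENNReal.toReal_mul, Module.finrank_fin_fun,
    ENNReal.toReal_ofReal (abs_nonneg _), abs_of_pos (by positivity)]

omit [Fintype ι] [DecidableEq ι] in
theorem volume_polyhedron_add {x : ι → ℝ} {v : Fin n → ℝ} (h : ∀ j ∈ J, τ j x = u j v)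
    (t : ι → ℝ) : volume (polyhedron J u τ (t + x)) = volume (polyhedron J u τ t) := by
  have : polyhedron J u τ (t + x) = (fun y => y + -v) ⁻¹' polyhedron J u τ t := by
    ext y
    refine forall₂_congr fun j hj => ?_
    rw [map_add, map_add, h j hj, map_neg]
    constructor <;> intro h <;> linarith
  rw [this, measure_preimage_add_right]

theorem IsAdditiveSystem.exists_polynomial (h : IsAdditiveSystem C J u τ) (hC : IsOpenCone C)
    (hn : n ≠ 0) {P : ι → MvPolynomial ι ℝ} (hP : ∀ j ∈ J, (P j).IsHomogeneous (n - 1))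
    (hincr : ∀ j ∈ J, ∀ t, ∀ ε ≥ 0,
      (∀ r ∈ Set.Icc 0 ε, t + r • (Pi.single j 1 : ι → ℝ) ∈ C) →
      (volume (polyhedron J u τ (t + ε • Pi.single j 1))).toReal -
        (volume (polyhedron J u τ t)).toReal =
          ∫ r in (0 : ℝ)..ε, MvPolynomial.eval (t + r • Pi.single j 1) (P j)) :
    ∃ p : MvPolynomial ι ℝ, p.IsHomogeneous n ∧
      (∀ t ∈ C, (volume (polyhedron J u τ t)).toReal = MvPolynomial.eval t p) ∧
      (∀ j ∈ J, MvPolynomial.dirDeriv (Pi.single j 1) p = P j) ∧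
      ∀ x v, (∀ j ∈ J, τ j x = u j v) → MvPolynomial.dirDeriv x p = 0 := by
  set f : (ι → ℝ) → ℝ := fun t => (volume (polyhedron J u τ t)).toReal with hf
  have hn0 : (n : ℝ) ≠ 0 := by exact_mod_cast hn
  have hd : ∀ j ∈ J, ∀ t ∈ C, HasDerivAt (fun r : ℝ => f (t + r • (Pi.single j 1 : ι → ℝ)))
      (MvPolynomial.eval t (P j)) 0 := fun j hj t ht =>
    hasDerivAt_line_of_integral (g := fun t => MvPolynomial.eval t (P j)) hC.isOpen
      (MvPolynomial.continuous_eval _) (fun t ε hε hseg => hincr j hj t ε hε hseg) ht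
  have heuler : ∀ t ∈ C, f t = (n : ℝ)⁻¹ * ∑ j ∈ J, τ j t * MvPolynomial.eval t (P j) := by
    intro t ht
    have h1 := hasDerivAt_line_sum hC.isOpen J
      (fun j _ => (MvPolynomial.continuous_eval (P j)).continuousOn) hd (fun j => τ j t) ht
    have h2 : HasDerivAt (fun r : ℝ => (1 + r) ^ n * f t) (n * f t) 0 := by
      have := (((hasDerivAt_id (0 : ℝ)).const_add 1).fun_pow n).mul_const (f t)
      simpa using this
    have h3 : (fun r : ℝ => f (t + r • ∑ j ∈ J, τ j t • (Pi.single j 1 : ι → ℝ))) =ᶠ[nhds 0]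
        fun r : ℝ => (1 + r) ^ n * f t := by
      filter_upwards [Ioi_mem_nhds (show (-1 : ℝ) < 0 by norm_num)] with r hr
      have hr' : 0 < 1 + r := by have : -1 < r := hr; linarith
      rw [← toReal_volume_polyhedron_smul hr']
      have : polyhedron J u τ (t + r • ∑ j ∈ J, τ j t • (Pi.single j 1 : ι → ℝ)) =
          polyhedron J u τ ((1 + r) • t) := by
        ext x
        refine forall₂_congr fun j hj => ?_
        have : τ j (∑ k ∈ J, τ k t • (Pi.single k 1 : ι → ℝ)) = τ j t := by
          rw [map_sum, Finset.sum_eq_single_of_mem j hj]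
          · rw [map_smul, h.apply_single j hj j hj]; simp
          · intro k hk hkj
            rw [map_smul, h.apply_single j hj k hk, if_neg hkj.symm, smul_zero]
        rw [map_add, map_smul, this, map_smul, add_smul, one_smul]
      simp only [hf, this]
    have h4 := (h2.congr_of_eventuallyEq h3).unique h1
    rw [← h4, inv_mul_cancel_left₀ hn0]
  set p : MvPolynomial ι ℝ :=
    MvPolynomial.C (n : ℝ)⁻¹ * ∑ j ∈ J, (τ j).toMvPolynomialReal * P j with hp
  have hfp : ∀ t ∈ C, f t = MvPolynomial.eval t p := fun t ht => by
    rw [heuler t ht, hp]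
    simp only [map_mul, map_sum, MvPolynomial.eval_C, LinearMap.eval_toMvPolynomialReal]
  have hderiv : ∀ x, ∀ t ∈ C, HasDerivAt (fun r : ℝ => f (t + r • x))
      (MvPolynomial.eval t (MvPolynomial.dirDeriv x p)) 0 := fun x t ht => by
    have h1 := MvPolynomial.hasDerivAt_eval_line p t x 0
    rw [zero_smul, add_zero] at h1
    refine h1.congr_of_eventuallyEq ?_
    obtain ⟨δ, hδ, hmem⟩ := hC.exists_forall_add_smul_mem ht x
    filter_upwards [Metric.ball_mem_nhds (0 : ℝ) hδ] with r hr
    exact hfp _ (hmem r (by simpa using hr))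
  refine ⟨p, ?_, hfp, fun j hj => ?_, fun x v hxv => ?_⟩
  · refine MvPolynomial.IsHomogeneous.C_mul (MvPolynomial.IsHomogeneous.sum _ _ _ fun j hj => ?_) _
    have := (LinearMap.isHomogeneous_toMvPolynomialReal (τ j)).mul (hP j hj)
    rwa [show 1 + (n - 1) = n by omega] at this
  · exact MvPolynomial.eq_of_eqOn_isOpen hC.isOpen hC.nonempty fun t ht =>
      (hderiv _ t ht).unique (hd j hj t ht)
  · refine MvPolynomial.eq_of_eqOn_isOpen hC.isOpen hC.nonempty fun t ht =>
      (hderiv _ t ht).unique ?_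
    rw [map_zero]
    refine (hasDerivAt_const (0 : ℝ) (f t)).congr_of_eventuallyEq (.of_forall fun r => ?_)
    simp only [hf]
    rw [volume_polyhedron_add (v := r • v)]
    intro j hj
    rw [map_smul, map_smul, hxv j hj]

end

theorem mul_deriv_deriv_le_sq_of_forall_mul_neg_le {h h' h'' : ℝ → ℝ}
    (h1 : ∀ r, HasDerivAt h (h' r) r) (h2 : ∀ r, HasDerivAt h' (h'' r) r)
    (hle : ∀ᶠ r in nhds 0, h r * h (-r) ≤ h 0 ^ 2) : h 0 * h'' 0 ≤ h' 0 ^ 2 := by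
  by_contra! hlt
  have hneg : ∀ {k k' : ℝ → ℝ}, (∀ r, HasDerivAt k (k' r) r) →
      ∀ r, HasDerivAt (fun r => k (-r)) (-k' (-r)) r := fun hk r => by
    simpa [Function.comp_def] using
      HasDerivAt.comp (h := fun r : ℝ => -r) r (hk (-r)) (hasDerivAt_neg r)
  have d1 : ∀ r, HasDerivAt (fun r => h r * h (-r)) (h' r * h (-r) + h r * -h' (-r)) r := fun r =>
    (h1 r).mul (hneg h1 r)
  have d2 : HasDerivAt (fun r => h' r * h (-r) + h r * -h' (-r))
      (2 * (h 0 * h'' 0 - h' 0 ^ 2)) 0 := by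
    refine (((h2 0).mul (hneg h1 0)).add ((h1 0).mul (hneg h2 0).neg)).congr_deriv ?_
    simp
    ring
  have e1 : deriv (fun r => h r * h (-r)) = fun r => h' r * h (-r) + h r * -h' (-r) :=
    funext fun r => (d1 r).deriv
  have hmin : IsLocalMin (fun r => h r * h (-r)) 0 := by
    refine isLocalMin_of_deriv_deriv_pos ?_ ?_ (d1 0).continuousAt
    · rw [e1, d2.deriv]
      linarith
    · rw [e1]
      simp
      ring
  have hev : (fun r => h r * h (-r)) =ᶠ[nhds 0] fun _ => h 0 ^ 2 := by
    filter_upwards [hmin, hle] with r hr1 hr2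
    simp only [neg_zero] at hr1
    exact le_antisymm hr2 (by rw [sq]; exact hr1)
  have e2 : deriv (fun r => h r * h (-r)) =ᶠ[nhds 0] fun _ => 0 := by
    filter_upwards [hev.eventuallyEq_nhds] with r hr
    rw [hr.deriv_eq, deriv_const]
  have e3 := e2.deriv_eq
  rw [e1, d2.deriv, deriv_const] at e3
  linarith

namespace MvPolynomial

variable {ι : Type} [Fintype ι]

/-- The polarization of a polynomial with all but two arguments fixed, as a bilinear form. -/
noncomputable def polarForm (l : List (ι → ℝ)) (p : MvPolynomial ι ℝ) :
    (ι → ℝ) →ₗ[ℝ] (ι → ℝ) →ₗ[ℝ] ℝ :=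
  LinearMap.mk₂ ℝ (fun x y => polar (x :: y :: l) p) (fun x x' y => by simp [polar_cons])
    (fun c x y => by simp [polar_cons]) (fun x y y' => by simp [polar_cons])
    (fun c x y => by simp [polar_cons])

theorem polarForm_apply (l : List (ι → ℝ)) (p : MvPolynomial ι ℝ) (x y : ι → ℝ) :
    polarForm l p x y = polar (x :: y :: l) p := rfl

theorem polarForm_comm (l : List (ι → ℝ)) (p : MvPolynomial ι ℝ) (x y : ι → ℝ) :
    polarForm l p x y = polarForm l p y x :=
  polar_perm (List.Perm.swap _ _ _) p

/-- The infinitesimal form of the Brunn–Minkowski inequality. -/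
theorem IsHomogeneous.polarForm_replicate_nonpos {n : ℕ} {p : MvPolynomial ι ℝ}
    (hp : p.IsHomogeneous (n + 2)) {C : Set (ι → ℝ)} (hC : IsOpenCone C)
    (hbm : ∀ t ∈ C, ∀ s ∈ C, 4 ^ (n + 2) * (eval t p * eval s p) ≤ eval (t + s) p ^ 2)
    {y : ι → ℝ} (hy : y ∈ C) (hpos : 0 < eval y p) {x : ι → ℝ}
    (hx : polarForm (List.replicate n y) p x y = 0) :
    polarForm (List.replicate n y) p x x ≤ 0 := by
  have h1 := mul_deriv_deriv_le_sq_of_forall_mul_neg_le (fun r => hasDerivAt_eval_line p y x r)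
    (fun r => hasDerivAt_eval_line (MvPolynomial.dirDeriv x p) y x r) (by
      obtain ⟨δ, hδ, hmem⟩ := hC.exists_forall_add_smul_mem hy x
      filter_upwards [Metric.ball_mem_nhds (0 : ℝ) hδ] with r hr
      have hr' : |r| < δ := by simpa using hr
      have := hbm _ (hmem r hr') _ (hmem (-r) (by simpa using hr'))
      have e : y + r • x + (y + -r • x) = (2 : ℝ) • y := by module
      rw [e, hp.eval_smul, mul_pow, ← pow_mul, mul_comm (n + 2) 2, pow_mul] at this
      norm_num at this
      simpa using this)
  have e1 : polar (List.replicate (n + 1) y) (MvPolynomial.dirDeriv x p) =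
      (n + 1).factorial * eval y (MvPolynomial.dirDeriv x p) := (hp.dirDeriv x).polar_replicate y
  have e2 : polar (List.replicate n y) (MvPolynomial.dirDeriv x (MvPolynomial.dirDeriv x p)) =
      n.factorial * eval y (MvPolynomial.dirDeriv x (MvPolynomial.dirDeriv x p)) :=
    ((hp.dirDeriv x).dirDeriv x).polar_replicate y
  have e3 : eval y (MvPolynomial.dirDeriv x p) = 0 := by
    rw [polarForm_apply, polar_cons, ← List.replicate_succ, e1] at hx
    exact (mul_eq_zero.1 hx).resolve_left (by positivity)
  simp only [zero_smul, add_zero, e3] at h1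
  rw [polarForm_apply, polar_cons, polar_cons, e2]
  refine mul_nonpos_of_nonneg_of_nonpos (by positivity) ?_
  by_contra! hlt
  nlinarith

/-- Positivity and Alexandrov–Fenchel type inequalities for the polarization of a polynomial on a
cone. -/
structure IsLorentzianOn [DecidableEq ι] (C : Set (ι → ℝ)) (J : Finset ι) (n : ℕ)
    (p : MvPolynomial ι ℝ) : Prop where
  isHomogeneous : p.IsHomogeneous n
  pos : ∀ l : List (ι → ℝ), (∀ t ∈ l, t ∈ C) → l.length = n → 0 < polar l p
  polar_mul_le : ∀ l : List (ι → ℝ), (∀ t ∈ l, t ∈ C) → l.length + 2 = n → ∀ y ∈ C, ∀ x,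
    polar (x :: x :: l) p * polar (y :: y :: l) p ≤ polar (x :: y :: l) p ^ 2
  facet : ∀ j ∈ J, dirDeriv (Pi.single j 1) p = 0 ∨ ∀ l : List (ι → ℝ), (∀ t ∈ l, t ∈ C) →
    l.length + 1 = n → 0 < polar (Pi.single j 1 :: l) p

end MvPolynomial

namespace MvPolynomial

variable {ι : Type} [Fintype ι] [DecidableEq ι] {C : Set (ι → ℝ)} {J : Finset ι}

/-- The induction step for the Alexandrov–Fenchel inequality: it passes from the derivatives of a
polynomial to the polynomial itself. -/
theorem IsLorentzianOn.of_dirDeriv {m : ℕ} {p : MvPolynomial ι ℝ} {P : ι → MvPolynomial ι ℝ}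
    {τ : ι → (ι → ℝ) →ₗ[ℝ] ℝ} (hC : IsOpenCone C) (hp : p.IsHomogeneous (m + 1))
    (hbm : ∀ t ∈ C, ∀ s ∈ C, 4 ^ (m + 1) * (eval t p * eval s p) ≤ eval (t + s) p ^ 2)
    (hpos : ∀ t ∈ C, 0 < eval t p)
    (hP : ∀ j ∈ J, dirDeriv (Pi.single j 1) p = P j)
    (hτ : ∀ x, dirDeriv x p = ∑ j ∈ J, τ j x • P j)
    (hcoef : ∀ t ∈ C, ∃ c : ι → ℝ, (∀ j ∈ J, 0 < c j) ∧ dirDeriv t p = ∑ j ∈ J, c j • P j)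
    (hL : ∀ j ∈ J, P j = 0 ∨ IsLorentzianOn C (J.erase j) m (P j)) :
    IsLorentzianOn C J (m + 1) p := by
  have hPnn : ∀ j ∈ J, ∀ l : List (ι → ℝ), (∀ t ∈ l, t ∈ C) → l.length = m →
      0 ≤ polar l (P j) := fun j hj l hl hlen => by
    rcases hL j hj with h | h
    · simp [h]
    · exact (h.pos l hl hlen).le
  have hexists : ∃ j ∈ J, P j ≠ 0 := by
    by_contra! h0
    obtain ⟨t, ht⟩ := hC.nonempty
    obtain ⟨c, -, hc⟩ := hcoef t ht
    have h1 := hp.eval_dirDeriv_self t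
    rw [hc, Finset.sum_eq_zero fun j hj => by rw [h0 j hj, smul_zero], map_zero] at h1
    have := hpos t ht
    have : (0 : ℝ) < (m + 1 : ℕ) * eval t p := by positivity
    linarith
  have hposl : ∀ l : List (ι → ℝ), (∀ t ∈ l, t ∈ C) → l.length = m + 1 → 0 < polar l p := by
    rintro (_ | ⟨t, l⟩) hl hlen
    · simp at hlen
    obtain ⟨c, hc0, hc⟩ := hcoef t (hl t (by simp))
    have hl' : ∀ t ∈ l, t ∈ C := fun t ht => hl t (List.mem_cons_of_mem _ ht)
    have hlen' : l.length = m := by simpa using hlen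
    rw [polar_cons, hc, map_sum]
    obtain ⟨i, hi, hPi⟩ := hexists
    refine Finset.sum_pos' (fun j hj => ?_) ⟨i, hi, ?_⟩
    · rw [map_smul]
      exact mul_nonneg (hc0 j hj).le (hPnn j hj l hl' hlen')
    · rw [map_smul]
      exact mul_pos (hc0 i hi) (((hL i hi).resolve_left hPi).pos l hl' hlen')
  have hdiag : ∀ k, m + 1 = k + 2 → ∀ y ∈ C, ∀ x, polarForm (List.replicate k y) p x y = 0 →
      polarForm (List.replicate k y) p x x ≤ 0 := fun k hk y hy x hx => by
    rw [hk] at hp hbm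
    exact hp.polarForm_replicate_nonpos hC hbm hy (hpos y hy) hx
  refine ⟨hp, hposl, ?_, fun j hj => ?_⟩
  swap
  · rcases hL j hj with h | h
    · exact Or.inl ((hP j hj).trans h)
    · refine Or.inr fun l hl hlen => ?_
      rw [polar_cons, hP j hj]
      exact h.pos l hl (by omega)
  rintro (_ | ⟨z, l⟩) hl hlen y hy x
  · have hm : m + 1 = 0 + 2 := by simpa using hlen.symm
    have hyy : 0 < polarForm [] p y y := hposl [y, y] (by simp [hy]) (by simp [hm])
    exact LinearMap.mul_le_sq_of_nonpos_of_orthogonal (polarForm [] p) (polarForm_comm [] p)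
      (hdiag 0 hm y hy) hyy hyy x
  obtain ⟨k, rfl⟩ : ∃ k, m = k + 2 := ⟨l.length, by simpa using hlen.symm⟩
  have hlk : l.length = k := by simpa using hlen
  have hz : z ∈ C := hl z (by simp)
  have hlC : ∀ t ∈ l, t ∈ C := fun t ht => hl t (List.mem_cons_of_mem _ ht)
  set B := polarForm (z :: l) p with hB
  have hBC : ∀ s ∈ C, ∀ t ∈ C, 0 < B s t := fun s hs t ht =>
    hposl (s :: t :: z :: l) (by simpa [hs, ht, hz] using hlC) (by simp [hlk])
  refine LinearMap.mul_le_sq_of_nonpos_of_orthogonal B (polarForm_comm _ p) (z := z)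
    (fun x hx => ?_)
    (hBC y hy z hz) (hBC y hy y hy) x
  obtain ⟨c, hc0, hc⟩ := hcoef z hz
  have hBz : ∀ x y, B x y = polar (x :: y :: l) (dirDeriv z p) := fun x y =>
    polar_perm (l' := z :: x :: y :: l)
      ((List.Perm.swap z y l).cons x |>.trans (List.Perm.swap z x _)) p
  have hBe : ∀ i ∈ J, ∀ x, B (Pi.single i 1) x = polar (x :: z :: l) (P i) := fun i hi x => by
    rw [hB, polarForm_apply, polar_cons, hP i hi]
  -- restriction to the facets with nonzero derivative
  let κ := {j // j ∈ J ∧ P j ≠ 0}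
  have hLκ : ∀ i : κ, IsLorentzianOn C (J.erase i) (k + 2) (P i) := fun i =>
    (hL i i.2.1).resolve_left i.2.2
  have hsum : ∀ (a : ι → ℝ) (f : ι → ℝ), (∀ j ∈ J, P j = 0 → f j = 0) →
      ∑ j ∈ J, a j * f j = ∑ j : κ, a j * f j := fun a f hf => by
    rw [← Finset.sum_subtype (J.filter fun j => P j ≠ 0) (by simp) fun j => a j * f j,
      Finset.sum_filter_of_ne]
    intro j hj hne hPj
    exact hne (by rw [hf j hj hPj, mul_zero])
  have hpol : ∀ l', polar l' (dirDeriv z p) = ∑ j : κ, c j * polar l' (P j) := fun l' => by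
    rw [← hsum c (fun j => polar l' (P j)) (fun j _ h => by simp [h]), hc]
    simp
  have hBτ : ∀ w x, B w x = ∑ j : κ, τ j w * B (Pi.single j.1 1) x := fun w x => by
    rw [← hsum (fun j => τ j w) (fun j => B (Pi.single j 1) x)
      (fun j hj h => by simp [hBe j hj, h]), hB, polarForm_apply, polar_cons, hτ, map_sum]
    refine Finset.sum_congr rfl fun j hj => ?_
    rw [map_smul, smul_eq_mul, ← hB, hBe j hj]
  have hBc : ∀ x, B z x = ∑ j : κ, c j * B (Pi.single j.1 1) x := fun x => by
    rw [hB, polarForm_apply, polar_cons, hpol, ← hB]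
    exact Finset.sum_congr rfl fun j _ => by rw [hBe j j.2.1]
  have hBs : ∀ x y, B x y = B y x := polarForm_comm _ p
  have hc0' : ∀ i : κ, 0 < c i := fun i => hc0 i i.2.1
  let A : Matrix κ κ ℝ := fun i j => B (Pi.single i.1 1) (Pi.single j.1 1)
  let b : κ → ℝ := fun i => B (Pi.single i.1 1) z
  have hb : ∀ i, 0 < b i := fun i => by
    have := (hLκ i).pos (z :: z :: l) (by simpa [hz] using hlC) (by simp [hlk])
    rwa [← hBe i i.2.1] at this
  have hfac : ∀ i j : κ, i ≠ j → dirDeriv (Pi.single j.1 1) (P i) = 0 ∨ 0 < A i j := by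
    intro i j hij
    refine ((hLκ i).facet j
      (Finset.mem_erase.2 ⟨fun h => hij (Subtype.ext h.symm), j.2.1⟩)).imp_right
      fun h => ?_
    have := h (z :: l) (by simpa [hz] using hlC) (by simp [hlk])
    rwa [← hBe i i.2.1] at this
  have hBx : B x x = (fun j : κ => τ j x) ⬝ᵥ A.mulVec fun j => τ j x := by
    rw [hBτ]
    refine Finset.sum_congr rfl fun i _ => ?_
    rw [hBs, hBτ]
    congr 1
    exact Finset.sum_congr rfl fun j _ => by rw [hBs, mul_comm]
  rw [hBx]
  refine Matrix.dotProduct_mulVec_nonpos_of_le_sum (c := fun i : κ => c i) (b := b)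
    (Matrix.IsSymm.ext fun i j => hBs _ _) hc0' hb ?_ ?_ ?_ ?_ ?_
  · ext i
    change ∑ j : κ, A i j * c j = B _ z
    rw [hBs, hBc]
    exact Finset.sum_congr rfl fun j _ => by rw [mul_comm, hBs]
  · intro i j hij
    rcases hfac i j hij with h | h
    · refine ((hBe i i.2.1 _).trans ?_).ge
      rw [polar_cons, h, map_zero]
    · exact h.le
  · intro I hI hI'
    by_contra! h0
    have h0' : ∀ i ∈ I, ∀ j ∉ I, dirDeriv (Pi.single j.1 1) (P i) = 0 := fun i hi j hj =>
      (hfac i j fun h => hj (h ▸ hi)).resolve_right (h0 i hi j hj).not_gt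
    set Q := polarForm (List.replicate (k + 1) z) p with hQ
    have hQs : ∀ x y, Q x y = Q y x := polarForm_comm _ p
    have hQe : ∀ i : κ, ∀ x, Q (Pi.single i.1 1) x = polar (x :: List.replicate (k + 1) z) (P i) :=
      fun i x => by rw [hQ, polarForm_apply, polar_cons, hP i i.2.1]
    have hQc : ∀ x, Q z x = ∑ j : κ, c j * Q (Pi.single j.1 1) x := fun x => by
      rw [hQ, polarForm_apply, polar_cons, hpol, ← hQ]
      exact Finset.sum_congr rfl fun j _ => by rw [hQe]
    have hQz : ∀ i : κ, 0 < Q (Pi.single i.1 1) z := fun i => by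
      rw [hQe, ← List.replicate_succ]
      exact (hLκ i).pos _ (fun t ht => by rwa [List.eq_of_mem_replicate ht]) (by simp)
    let w : Set κ → ι → ℝ := fun S => ∑ i : κ, S.indicator (fun i => c i) i • Pi.single i.1 1
    have hw : ∀ S x, Q (w S) x = ∑ i : κ, S.indicator (fun i => c i) i * Q (Pi.single i.1 1) x :=
      fun S x => by simp [w, map_sum]
    have hadd : ∀ x, Q z x = Q (w I) x + Q (w Iᶜ) x := fun x => by
      rw [hw, hw, hQc, ← Finset.sum_add_distrib]
      refine Finset.sum_congr rfl fun i _ => ?_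
      rw [← add_mul, ← Pi.add_apply, Set.indicator_self_add_compl]
    have hort : Q (w I) (w Iᶜ) = 0 := by
      rw [hw]
      refine Finset.sum_eq_zero fun i _ => ?_
      by_cases hi : i ∈ I
      · rw [hQs, hw, Finset.sum_eq_zero, mul_zero]
        intro j _
        by_cases hj : j ∈ I
        · simp [hj]
        · rw [hQs, hQe, polar_cons, h0' i hi j hj, map_zero, mul_zero]
      · simp [hi]
    have hwz : ∀ S : Set κ, S.Nonempty → 0 < Q (w S) z := fun S ⟨i, hi⟩ => by
      rw [hw]
      refine Finset.sum_pos' (fun j _ => mul_nonneg ?_ (hQz j).le) ⟨i, Finset.mem_univ _, ?_⟩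
      · exact Set.indicator_nonneg (fun j _ => (hc0' j).le) j
      · rw [Set.indicator_of_mem hi]
        exact mul_pos (hc0' i) (hQz i)
    have h1 : 0 < Q (w I) (w I) := by
      have := hadd (w I)
      rw [hQs, hQs (w Iᶜ), hort] at this
      linarith [hwz I hI]
    have h2 : 0 < Q (w Iᶜ) (w Iᶜ) := by
      have := hadd (w Iᶜ)
      rw [hQs, hort] at this
      linarith [hwz Iᶜ hI']
    have h3 := LinearMap.mul_le_sq_of_nonpos_of_orthogonal Q hQs (hdiag (k + 1) rfl z hz)
      (hwz Iᶜ hI') h2 (w I)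
    rw [hort] at h3
    have := mul_pos h1 h2
    linarith
  · intro a
    set X : ι → ℝ := ∑ j : κ, a j • Pi.single j.1 1 with hX
    have hBX : ∀ v, B X v = ∑ j : κ, a j * B (Pi.single j.1 1) v := fun v => by
      simp [hX, map_sum]
    have hAa : ∀ i, A.mulVec a i = polar (X :: z :: l) (P i) := fun i => by
      rw [← hBe i i.2.1, hBs, hBX]
      exact Finset.sum_congr rfl fun j _ => by rw [mul_comm, hBs]
    have hXX : a ⬝ᵥ A.mulVec a = B X X := by
      rw [hBX]
      exact Finset.sum_congr rfl fun j _ => by rw [hAa, hBe j j.2.1]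
    rw [hXX, hBz, hpol]
    refine Finset.sum_le_sum fun i _ => ?_
    have h1 := (hLκ i).polar_mul_le l hlC (by omega) z hz X
    have h2 : b i = polar (z :: z :: l) (P i) := hBe i i.2.1 z
    rw [← h2, ← hAa] at h1
    rw [div_mul_eq_mul_div, le_div_iff₀ (hb i), mul_assoc]
    exact mul_le_mul_of_nonneg_left h1 (hc0' i).le
  · rw [← hx, hBτ]
    rfl

end MvPolynomial

section

variable {ι : Type} [Fintype ι] [DecidableEq ι] {C : Set (ι → ℝ)} {J : Finset ι}

theorem MvPolynomial.IsLorentzianOn.C_mul {n : ℕ} {p : MvPolynomial ι ℝ}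
    (h : MvPolynomial.IsLorentzianOn C J n p) {c : ℝ} (hc : 0 < c) :
    MvPolynomial.IsLorentzianOn C J n (MvPolynomial.C c * p) := by
  rw [← MvPolynomial.smul_eq_C_mul]
  refine ⟨(MvPolynomial.homogeneousSubmodule ι ℝ n).smul_mem c h.isHomogeneous,
    fun l hl hlen => ?_, fun l hl hlen y hy x => ?_, fun j hj => ?_⟩
  · rw [map_smul]
    exact mul_pos hc (h.pos l hl hlen)
  · have := mul_le_mul_of_nonneg_left (h.polar_mul_le l hl hlen y hy x) (sq_nonneg c)
    simp only [map_smul, smul_eq_mul]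
    linarith
  · refine (h.facet j hj).imp (fun h0 => by rw [map_smul, h0, smul_zero]) fun h0 l hl hlen => ?_
    rw [map_smul]
    exact mul_pos hc (h0 l hl hlen)

theorem IsAdditiveSystem.apply_ne_zero {n : ℕ} {u : ι → (Fin n → ℝ) →ₗ[ℝ] ℝ}
    {τ : ι → (ι → ℝ) →ₗ[ℝ] ℝ} (h : IsAdditiveSystem C J u τ) (hC : IsOpenCone C) {j : ι}
    (hj : j ∈ J) (ht : ∀ t ∈ C, IsTight J u τ j t) : u j ≠ 0 := by
  intro hu
  have hz : ∀ t ∈ C, τ j t = 0 := fun t htC => by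
    obtain ⟨x, -, hx⟩ := ht t htC
    rw [← hx, hu, LinearMap.zero_apply]
  obtain ⟨t, htC⟩ := hC.nonempty
  obtain ⟨δ, hδ, hmem⟩ := hC.exists_forall_add_smul_mem htC (Pi.single j 1)
  have := hz _ (hmem (δ / 2) (by rw [abs_of_pos (by positivity)]; linarith))
  rw [h.apply_add_single hj hj, hz t htC, if_pos rfl] at this
  linarith

/-- A vector satisfying all the inequalities strictly. -/
theorem IsAdditiveSystem.exists_lt {n : ℕ} {u : ι → (Fin n → ℝ) →ₗ[ℝ] ℝ}
    {τ : ι → (ι → ℝ) →ₗ[ℝ] ℝ} (h : IsAdditiveSystem C J u τ) (hC : IsOpenCone C) {t : ι → ℝ}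
    (ht : t ∈ C) : ∃ v, ∀ j ∈ J, u j v < τ j t := by
  obtain ⟨δ, hδ, hmem⟩ := hC.exists_forall_add_smul_mem ht (∑ j ∈ J, Pi.single j 1)
  have h1 := hmem (-(δ / 2)) (by rw [abs_neg, abs_of_pos (by positivity)]; linarith)
  obtain ⟨v, hv⟩ := h.nonempty _ h1
  refine ⟨v, fun j hj => (hv j hj).trans_lt ?_⟩
  have : τ j (∑ k ∈ J, Pi.single k 1) = 1 := by
    rw [map_sum, Finset.sum_congr rfl fun k hk => h.apply_single j hj k hk]
    simp [hj]
  rw [map_add, map_smul, this, smul_eq_mul]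
  linarith

theorem IsAdditiveSystem.toReal_volume_pos {n : ℕ} {u : ι → (Fin n → ℝ) →ₗ[ℝ] ℝ}
    {τ : ι → (ι → ℝ) →ₗ[ℝ] ℝ} (h : IsAdditiveSystem C J u τ) (hC : IsOpenCone C) {t : ι → ℝ}
    (ht : t ∈ C) : 0 < (volume (polyhedron J u τ t)).toReal := by
  refine ENNReal.toReal_pos (fun h0 => ?_) (h.isCompact t ht).measure_lt_top.ne
  obtain ⟨v, hv⟩ := h.exists_lt hC ht
  have hopen : IsOpen {x | ∀ j ∈ J, u j x < τ j t} := by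
    have : {x | ∀ j ∈ J, u j x < τ j t} = ⋂ j ∈ J, {x | u j x < τ j t} := by ext; simp
    rw [this]
    exact isOpen_biInter_finset fun j _ =>
      isOpen_lt (u j).continuous_of_finiteDimensional continuous_const
  exact (hopen.measure_pos volume ⟨v, hv⟩).ne'
    (measure_mono_null (fun x hx j hj => (hx j hj).le) h0)

/-- The volume of the members of an additive system is a Lorentzian polynomial. -/
theorem IsAdditiveSystem.exists_isLorentzianOn (hC : IsOpenCone C) {n : ℕ} :
    ∀ {J : Finset ι} {u : ι → (Fin n → ℝ) →ₗ[ℝ] ℝ} {τ : ι → (ι → ℝ) →ₗ[ℝ] ℝ},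
      IsAdditiveSystem C J u τ → ∃ p : MvPolynomial ι ℝ, MvPolynomial.IsLorentzianOn C J n p ∧
        ∀ t ∈ C, (volume (polyhedron J u τ t)).toReal = MvPolynomial.eval t p := by
  induction n with
  | zero =>
    intro J u τ h
    refine ⟨MvPolynomial.C 1, ⟨MvPolynomial.isHomogeneous_C _ _, fun l hl hlen => ?_,
      fun l hl hlen => by omega, fun j hj => Or.inl (MvPolynomial.dirDeriv_C _ _)⟩,
      fun t ht => ?_⟩
    · rw [List.length_eq_zero_iff.1 hlen, MvPolynomial.polar_nil]
      simp
    · rw [Set.Nonempty.eq_univ (h.nonempty t ht), volume_pi, Measure.pi_univ]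
      simp
  | succ m ih =>
    intro J u τ h
    have hP : ∀ j : ι, ∃ P : MvPolynomial ι ℝ, j ∈ J →
        (P = 0 ∨ MvPolynomial.IsLorentzianOn C (J.erase j) m P) ∧
        ∀ t, ∀ ε ≥ 0, (∀ r ∈ Set.Icc 0 ε, t + r • (Pi.single j 1 : ι → ℝ) ∈ C) →
          (volume (polyhedron J u τ (t + ε • Pi.single j 1))).toReal -
            (volume (polyhedron J u τ t)).toReal =
              ∫ r in (0 : ℝ)..ε, MvPolynomial.eval (t + r • Pi.single j 1) P := fun j => by
      by_cases hj : j ∈ J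
      swap
      · exact ⟨0, fun h => absurd h hj⟩
      by_cases ht : ∃ t ∈ C, IsTight J u τ j t
      · obtain ⟨t, htC, ht⟩ := ht
        have ht' : ∀ s ∈ C, IsTight J u τ j s := fun s hs => h.isTight hC hj htC hs ht
        obtain ⟨c, u', τ', hc, h', hvol⟩ := h.exists_facet hj ht' (h.apply_ne_zero hC hj ht')
        obtain ⟨p, hp, hpv⟩ := ih h'
        refine ⟨MvPolynomial.C c * p, fun _ => ⟨Or.inr (hp.C_mul hc), fun t ε hε hmem => ?_⟩⟩
        rw [hvol (fun t => MvPolynomial.eval t p) (MvPolynomial.continuous_eval p) hpv t ε hε hmem]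
        simp
      · push Not at ht
        refine ⟨0, fun _ => ⟨Or.inl rfl, fun t ε hε hmem => ?_⟩⟩
        have htC : t ∈ C := by simpa using hmem 0 ⟨le_rfl, hε⟩
        rw [h.polyhedron_add_single_eq hj htC (ht t htC) hε]
        simp
    choose P hP using hP
    have hPhom : ∀ j ∈ J, (P j).IsHomogeneous m := fun j hj => by
      rcases (hP j hj).1 with h0 | h0
      · rw [h0]
        exact MvPolynomial.isHomogeneous_zero _ _ _
      · exact h0.isHomogeneous
    obtain ⟨p, hp, hvol, hdir, htrans⟩ := h.exists_polynomial hC (Nat.succ_ne_zero m) hPhom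
      fun j hj => (hP j hj).2
    have hderiv : ∀ x v, MvPolynomial.dirDeriv x p = ∑ j ∈ J, (τ j x - u j v) • P j :=
      fun x v => by
      have h1 := htrans (x - ∑ j ∈ J, (τ j x - u j v) • Pi.single j 1) v fun k hk => by
        rw [map_sub, map_sum, Finset.sum_congr rfl fun j hj => by
          rw [map_smul, h.apply_single k hk j hj]]
        simp [hk]
      rw [map_sub, LinearMap.sub_apply, sub_eq_zero, map_sum, LinearMap.sum_apply] at h1
      rw [h1]
      refine Finset.sum_congr rfl fun j hj => ?_
      rw [map_smul, LinearMap.smul_apply, hdir j hj]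
    refine ⟨p, .of_dirDeriv (P := P) (τ := τ) hC hp (fun t ht s hs => ?_) (fun t ht => ?_) hdir
      (fun x => by simpa using hderiv x 0) (fun t ht => ?_) fun j hj => (hP j hj).1, hvol⟩
    · rw [← hvol t ht, ← hvol s hs, ← hvol _ (hC.add_mem t ht s hs)]
      have hfin : volume (polyhedron J u τ (t + s)) ≠ ⊤ :=
        (h.isCompact _ (hC.add_mem t ht s hs)).measure_lt_top.ne
      have h1 := (volume_mul_volume_le_sq (h.isCompact t ht) (h.isCompact s hs)).trans
        (pow_le_pow_left' (measure_mono (Set.add_subset_iff.2 fun x hx y hy =>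
          add_mem_polyhedron hx hy)) 2)
      simpa using ENNReal.toReal_mono (ENNReal.pow_ne_top hfin) h1
    · rw [← hvol t ht]
      exact h.toReal_volume_pos hC ht
    · obtain ⟨v, hv⟩ := h.exists_lt hC ht
      exact ⟨fun j => τ j t - u j v, fun j hj => sub_pos.2 (hv j hj), hderiv t v⟩

end

section

variable {ι : Type} [DecidableEq ι] {n : ℕ} {u : ι → (Fin n → ℝ) →ₗ[ℝ] ℝ}

/-- The functionals `u i`, `i ∈ b`, form a basis of the dual space, with dual basis `w`. -/
structure IsDualBasisOn (u : ι → (Fin n → ℝ) →ₗ[ℝ] ℝ) (b : Finset ι) (w : ι → Fin n → ℝ) :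
    Prop where
  apply_eq : ∀ i ∈ b, ∀ k ∈ b, u i (w k) = if i = k then 1 else 0
  sum_eq : ∀ x, ∑ i ∈ b, u i x • w i = x

theorem exists_isDualBasisOn {a : Finset ι} (ha : ∀ x, (∀ i ∈ a, u i x = 0) → x = 0) :
    ∃ b ⊆ a, ∃ w, IsDualBasisOn u b w := by
  obtain ⟨b, hba, hb⟩ := exists_minimal_le_of_wellFoundedLT
    (fun b : Finset ι => ∀ x, (∀ i ∈ b, u i x = 0) → x = 0) a ha
  have hw : ∀ i, ∃ w, i ∈ b → ∀ k ∈ b, u k w = if k = i then 1 else 0 := fun i => by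
    by_cases hi : i ∈ b
    swap
    · exact ⟨0, fun h => absurd h hi⟩
    have h1 : ¬ ∀ x, (∀ k ∈ b.erase i, u k x = 0) → x = 0 := fun h =>
      Finset.notMem_erase i b (hb.2 h (Finset.erase_subset i b) hi)
    push Not at h1
    obtain ⟨x, hx, hx0⟩ := h1
    have hxi : u i x ≠ 0 := fun h => hx0 (hb.1 x fun k hk => by
      by_cases hki : k = i
      · rw [hki, h]
      · exact hx k (Finset.mem_erase.2 ⟨hki, hk⟩))
    refine ⟨(u i x)⁻¹ • x, fun _ k hk => ?_⟩
    by_cases hki : k = i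
    · rw [hki, map_smul, smul_eq_mul, inv_mul_cancel₀ hxi, if_pos rfl]
    · rw [map_smul, hx k (Finset.mem_erase.2 ⟨hki, hk⟩), smul_zero, if_neg hki]
  choose w hw using hw
  refine ⟨b, hba, w, fun i hi k hk => hw k hk i hi, fun x => sub_eq_zero.1 (hb.1 _ fun k hk => ?_)⟩
  rw [map_sub, map_sum, Finset.sum_congr rfl fun i hi => by rw [map_smul, hw i hi k hk]]
  simp [hk]

/-- The vertex of the polyhedron at which the inequalities in `b` are tight, as a linear function
of the right-hand side. -/
noncomputable def vertexMap (b : Finset ι) (w : ι → Fin n → ℝ) : (ι → ℝ) →ₗ[ℝ] (Fin n → ℝ) :=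
  ∑ i ∈ b, (LinearMap.proj i).smulRight (w i)

omit [DecidableEq ι] in
theorem vertexMap_apply (b : Finset ι) (w : ι → Fin n → ℝ) (t : ι → ℝ) :
    vertexMap b w t = ∑ i ∈ b, t i • w i := by
  simp [vertexMap]

variable {b : Finset ι} {w : ι → Fin n → ℝ}

theorem IsDualBasisOn.apply_vertexMap (h : IsDualBasisOn u b w) {i : ι} (hi : i ∈ b) (t : ι → ℝ) :
    u i (vertexMap b w t) = t i := by
  rw [vertexMap_apply, map_sum, Finset.sum_congr rfl fun k hk => by
    rw [map_smul, h.apply_eq i hi k hk]]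
  simp [hi]

theorem IsDualBasisOn.vertexMap_eq (h : IsDualBasisOn u b w) {t : ι → ℝ} {x : Fin n → ℝ}
    (hx : ∀ i ∈ b, u i x = t i) : vertexMap b w t = x := by
  rw [vertexMap_apply, ← h.sum_eq x]
  exact Finset.sum_congr rfl fun i hi => by rw [hx i hi]

theorem IsDualBasisOn.apply_le (h : IsDualBasisOn u b w) {ℓ : (Fin n → ℝ) →ₗ[ℝ] ℝ}
    (hℓ : ∀ i ∈ b, 0 ≤ ℓ (w i)) {t : ι → ℝ} {y : Fin n → ℝ} (hy : ∀ i, u i y ≤ t i) :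
    ℓ y ≤ ℓ (vertexMap b w t) := by
  conv_lhs => rw [← h.sum_eq y]
  rw [vertexMap_apply, map_sum, map_sum]
  refine Finset.sum_le_sum fun i hi => ?_
  rw [map_smul, map_smul]
  exact mul_le_mul_of_nonneg_right (hy i) (hℓ i hi)

variable [Fintype ι]

omit [DecidableEq ι] in
theorem exists_forall_add_smul_le {t : ι → ℝ} {x v : Fin n → ℝ}
    (hx : ∀ i, u i x ≤ t i) (hv : ∀ i, u i x = t i → u i v ≤ 0) :
    ∃ δ : ℝ, 0 < δ ∧ ∀ i, u i (x + δ • v) ≤ t i := by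
  have : ∀ i, ∀ᶠ δ : ℝ in nhdsWithin 0 (Set.Ioi 0), u i (x + δ • v) ≤ t i := fun i => by
    rcases (hx i).eq_or_lt with h | h
    · filter_upwards [self_mem_nhdsWithin] with δ hδ
      have := mul_nonpos_of_nonneg_of_nonpos (le_of_lt hδ) (hv i h)
      rw [map_add, map_smul, smul_eq_mul]
      linarith
    · have hcont : Continuous fun δ : ℝ => u i x + δ * u i v := by fun_prop
      filter_upwards [nhdsWithin_le_nhds
        (hcont.continuousAt.eventually_lt (x₀ := 0) (continuousAt_const (y := t i))
          (by simpa using h))] with δ hδ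
      rw [map_add, map_smul, smul_eq_mul]
      exact hδ.le
  obtain ⟨δ, h1, h2⟩ := ((Filter.eventually_all.2 this).and self_mem_nhdsWithin).exists
  exact ⟨δ, h2, h1⟩

omit [DecidableEq ι] in
/-- A linear functional on a polytope attains its maximum at a vertex. -/
theorem exists_isMax_forall_eq_zero {t : ι → ℝ} (hcpt : IsCompact {x | ∀ i, u i x ≤ t i})
    (hne : {x | ∀ i, u i x ≤ t i}.Nonempty) (ℓ : (Fin n → ℝ) →ₗ[ℝ] ℝ) :
    ∃ x, (∀ i, u i x ≤ t i) ∧ (∀ y, (∀ i, u i y ≤ t i) → ℓ y ≤ ℓ x) ∧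
      ∀ v, (∀ i, u i x = t i → u i v = 0) → v = 0 := by
  have hℓc : Continuous ℓ := ℓ.continuous_of_finiteDimensional
  obtain ⟨x₀, hx₀, hmax⟩ := hcpt.exists_isMaxOn hne hℓc.continuousOn
  obtain ⟨x, ⟨hxP, hxm⟩, hext⟩ := (hcpt.inter_right
    (isClosed_singleton.preimage hℓc : IsClosed (ℓ ⁻¹' {ℓ x₀}))).extremePoints_nonempty
    ⟨x₀, hx₀, rfl⟩
  have hxm : ℓ x = ℓ x₀ := hxm
  have hxP : ∀ i, u i x ≤ t i := hxP
  have hmax : ∀ y, (∀ i, u i y ≤ t i) → ℓ y ≤ ℓ x := fun y hy => hxm ▸ hmax hy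
  refine ⟨x, hxP, hmax, fun v hv => ?_⟩
  obtain ⟨δ₁, h₁, hm₁⟩ := exists_forall_add_smul_le hxP fun i hi => (hv i hi).le
  obtain ⟨δ₂, h₂, hm₂⟩ := exists_forall_add_smul_le (v := -v) hxP
    fun i hi => by rw [map_neg, hv i hi, neg_zero]
  have e1 := hmax _ hm₁
  have e2 := hmax _ hm₂
  rw [map_add, map_smul, smul_eq_mul] at e1 e2
  rw [map_neg] at e2
  have hℓv : ℓ v = 0 := by nlinarith
  have hmem : ∀ δ : ℝ, (∀ i, u i (x + δ • v) ≤ t i) →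
      x + δ • v ∈ {x | ∀ i, u i x ≤ t i} ∩ ℓ ⁻¹' {ℓ x₀} := fun δ h =>
    ⟨h, by simp [hℓv, hxm]⟩
  have := hext (hmem δ₁ hm₁) (hmem (-δ₂) (by simpa using hm₂))
    ⟨δ₂ / (δ₁ + δ₂), δ₁ / (δ₁ + δ₂), by positivity, by positivity, by field_simp; ring, by
      ext i
      simp
      field_simp
      ring⟩
  simpa [h₁.ne'] using this

/-- Linear programming duality at a generic right-hand side. -/
theorem exists_isDualBasisOn_nonneg {W : Finset ι → ι → Fin n → ℝ}
    (hW : ∀ b, (∃ w, IsDualBasisOn u b w) → IsDualBasisOn u b (W b)) {t : ι → ℝ}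
    (hcpt : IsCompact {x | ∀ i, u i x ≤ t i}) (hne : {x | ∀ i, u i x ≤ t i}.Nonempty)
    (hgen : ∀ b, IsDualBasisOn u b (W b) → ∀ j ∉ b, u j (vertexMap b (W b) t) ≠ t j)
    (ℓ : (Fin n → ℝ) →ₗ[ℝ] ℝ) :
    ∃ b, IsDualBasisOn u b (W b) ∧ (∀ j, u j (vertexMap b (W b) t) ≤ t j) ∧
      ∀ i ∈ b, 0 ≤ ℓ (W b i) := by
  obtain ⟨x, hxP, hmax, hact⟩ := exists_isMax_forall_eq_zero hcpt hne ℓ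
  obtain ⟨b, hba, hb⟩ := exists_isDualBasisOn (a := Finset.univ.filter fun i => u i x = t i)
    fun v hv => hact v (by simpa using hv)
  have hb := hW b hb
  have hbx : vertexMap b (W b) t = x := hb.vertexMap_eq fun i hi => by
    simpa using hba hi
  refine ⟨b, hb, fun j => hbx ▸ hxP j, fun i hi => ?_⟩
  obtain ⟨δ, hδ, hm⟩ := exists_forall_add_smul_le (v := -W b i) hxP fun j hj => by
    have hjb : j ∈ b := by
      by_contra hjb
      exact hgen b hb j hjb (hbx ▸ hj)
    rw [map_neg, hb.apply_eq j hjb i hi]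
    split_ifs <;> norm_num
  have := hmax _ hm
  rw [map_add, map_smul, map_neg, smul_eq_mul] at this
  nlinarith

end

section

variable {ι : Type} [Fintype ι] [DecidableEq ι] {n : ℕ}

omit [DecidableEq ι] in
theorem exists_generic {α : Type} [Finite α] (φ : α → (ι → ℝ) →ₗ[ℝ] ℝ) {t₀ : ι → ℝ}
    {U : Set (ι → ℝ)} (hU : IsOpen U) (ht₀ : t₀ ∈ U) :
    ∃ t ∈ U, ∀ a, (φ a ≠ 0 → φ a t ≠ 0) ∧ (φ a t₀ < 0 → φ a t < 0) := by
  have hcont : ∀ a, Continuous (φ a) := fun a => (φ a).continuous_of_finiteDimensional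
  have hae : ∀ᵐ t : ι → ℝ, ∀ a, φ a ≠ 0 → φ a t ≠ 0 := by
    refine ae_all_iff.2 fun a => ?_
    by_cases ha : φ a = 0
    · simp [ha]
    · have := Measure.addHaar_submodule (volume : Measure (ι → ℝ)) (LinearMap.ker (φ a))
        (by rwa [Ne, LinearMap.ker_eq_top])
      filter_upwards [measure_eq_zero_iff_ae_notMem.1 this] with t ht _ using ht
  have hopen : IsOpen (U ∩ ⋂ a, {t | φ a t₀ < 0 → φ a t < 0}) := by
    refine hU.inter (isOpen_iInter_of_finite fun a => ?_)
    by_cases ha : φ a t₀ < 0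
    · simpa [ha] using isOpen_lt (hcont a) continuous_const
    · simp [ha]
  obtain ⟨t, ht, ht'⟩ := (Measure.dense_of_ae hae).inter_open_nonempty _ hopen
    ⟨t₀, ht₀, by simp⟩
  exact ⟨t, ht.1, fun a => ⟨ht' a, Set.mem_iInter.1 ht.2 a⟩⟩

theorem isOpenCone_interior {E : Type} [NormedAddCommGroup E] [NormedSpace ℝ E] {D : Set E}
    (hadd : ∀ t ∈ D, ∀ s ∈ D, t + s ∈ D) (hsmul : ∀ r : ℝ, 0 < r → ∀ t ∈ D, r • t ∈ D)
    (hne : (interior D).Nonempty) : IsOpenCone (interior D) := by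
  refine ⟨isOpen_interior, hne, fun t ht s hs => ?_, fun r hr t ht => ?_⟩
  · exact interior_mono (Set.add_subset_iff.2 hadd)
      (subset_interior_add_left (Set.add_mem_add ht (interior_subset hs)))
  · have : r • interior D ⊆ interior D := by
      rw [← interior_smul₀ hr.ne']
      refine interior_mono ?_
      rintro _ ⟨x, hx, rfl⟩
      exact hsmul r hr x hx
    exact this (Set.smul_mem_smul_set ht)

theorem add_mem_interior_of_mem {E : Type} [NormedAddCommGroup E] {D : Set E}
    (hadd : ∀ t ∈ D, ∀ s ∈ D, t + s ∈ D) {t s : E} (ht : t ∈ D) (hs : s ∈ interior D) :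
    t + s ∈ interior D :=
  interior_mono (Set.add_subset_iff.2 hadd) (subset_interior_add_right (Set.add_mem_add ht hs))

/-- A family of polytopes whose facet functionals contain those of their sum lies in the closure
of an open cone on which the corresponding polyhedra are additive. -/
theorem exists_isAdditiveSystem {κ : Type} [Fintype κ] {u : ι → (Fin n → ℝ) →ₗ[ℝ] ℝ}
    (hcpt : ∀ t : ι → ℝ, IsCompact {x | ∀ i, u i x ≤ t i}) {s : κ → ι → ℝ} {x₀ : Fin n → ℝ}
    (hx₀ : ∀ i, u i x₀ < ∑ k, s k i)
    (hs : ∀ x, (∀ i, u i x ≤ ∑ k, s k i) →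
      ∃ y : κ → Fin n → ℝ, (∀ k i, u i (y k) ≤ s k i) ∧ x = ∑ k, y k) :
    ∃ (C : Set (ι → ℝ)) (t : ι → ℝ), IsOpenCone C ∧
      IsAdditiveSystem C Finset.univ u (fun i => LinearMap.proj i) ∧ (∀ i, 0 ≤ t i) ∧ t ∈ C ∧
      ∀ k, ∀ ε : ℝ, 0 < ε → s k + ε • t ∈ C ∧
        polyhedron Finset.univ u (fun i => LinearMap.proj i) (s k + ε • t) ⊆
          polyhedron Finset.univ u (fun i => LinearMap.proj i) (s k) +
            ε • polyhedron Finset.univ u (fun i => LinearMap.proj i) t := by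
  classical
  have hW : ∀ b : Finset ι, ∃ W, (∃ w, IsDualBasisOn u b w) → IsDualBasisOn u b W := fun b => by
    by_cases h : ∃ w, IsDualBasisOn u b w
    · exact ⟨h.choose, fun _ => h.choose_spec⟩
    · exact ⟨0, fun h' => absurd h' h⟩
  choose W hW using hW
  let φ : Finset ι × ι → (ι → ℝ) →ₗ[ℝ] ℝ := fun a =>
    LinearMap.proj a.2 - u a.2 ∘ₗ vertexMap a.1 (W a.1)
  have hφ : ∀ b j t, φ (b, j) t = t j - u j (vertexMap b (W b) t) := fun b j t => rfl
  have hφ0 : ∀ b, ∀ j ∉ b, φ (b, j) ≠ 0 := fun b j hj h => by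
    have h1 := hφ b j (Pi.single j 1)
    rw [h, vertexMap_apply, Finset.sum_eq_zero fun i hi => by
      rw [Pi.single_eq_of_ne (fun h : i = j => hj (h ▸ hi)), zero_smul]] at h1
    simp at h1
  have hU : IsOpen {t : ι → ℝ | ∀ i, u i x₀ < t i} := by
    rw [Set.ofPred_forall]
    exact isOpen_iInter_of_finite fun i => isOpen_lt continuous_const (continuous_apply i)
  obtain ⟨t₁, ht₁U, ht₁⟩ := exists_generic φ hU (t₀ := fun i => ∑ k, s k i) hx₀
  set t : ι → ℝ := fun i => t₁ i - u i x₀ with ht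
  have htpos : ∀ i, 0 < t i := fun i => sub_pos.2 (ht₁U i)
  have hφt : ∀ b, IsDualBasisOn u b (W b) → ∀ j, φ (b, j) t = φ (b, j) t₁ := fun b hb j => by
    have : vertexMap b (W b) t = vertexMap b (W b) t₁ - x₀ := hb.vertexMap_eq fun i hi => by
      rw [map_sub, hb.apply_vertexMap hi]
    rw [hφ, hφ, this, map_sub]
    simp only [ht]
    ring
  let 𝓑 : Set (Finset ι) := {b | IsDualBasisOn u b (W b) ∧ ∀ j, u j (vertexMap b (W b) t) ≤ t j}
  have hcert : ∀ ℓ : (Fin n → ℝ) →ₗ[ℝ] ℝ, ∃ b ∈ 𝓑, ∀ r : ι → ℝ, ∀ y, (∀ i, u i y ≤ r i) →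
      ℓ y ≤ ℓ (vertexMap b (W b) r) := fun ℓ => by
    obtain ⟨b, hb, hbt, hℓ⟩ := exists_isDualBasisOn_nonneg hW (hcpt t)
      ⟨0, fun i => by simpa using (htpos i).le⟩ (fun b hb j hj h => by
        have := (ht₁ (b, j)).1 (hφ0 b j hj)
        rw [← hφt b hb, hφ, h, sub_self] at this
        exact this rfl) ℓ
    exact ⟨b, ⟨hb, hbt⟩, fun r y hy => hb.apply_le hℓ hy⟩
  let D : Set (ι → ℝ) := {r | ∀ b ∈ 𝓑, ∀ j, u j (vertexMap b (W b) r) ≤ r j}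
  have hDadd : ∀ r ∈ D, ∀ r' ∈ D, r + r' ∈ D := fun r hr r' hr' b hb j => by
    rw [map_add, map_add]
    exact add_le_add (hr b hb j) (hr' b hb j)
  have hDsmul : ∀ c : ℝ, 0 < c → ∀ r ∈ D, c • r ∈ D := fun c hc r hr b hb j => by
    rw [map_smul, map_smul]
    exact mul_le_mul_of_nonneg_left (hr b hb j) hc.le
  have htD : t ∈ interior D := by
    have hopen : IsOpen {r : ι → ℝ | ∀ b, b ∈ 𝓑 → ∀ j, j ∉ b → 0 < φ (b, j) r} := by
      simp only [Set.ofPred_forall]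
      exact isOpen_iInter_of_finite fun b => isOpen_iInter_of_finite fun hb =>
        isOpen_iInter_of_finite fun j => isOpen_iInter_of_finite fun hj =>
          isOpen_lt continuous_const (φ (b, j)).continuous_of_finiteDimensional
    refine interior_maximal (fun r hr b hb j => ?_) hopen fun b hb j hj => ?_
    · by_cases hj : j ∈ b
      · exact (hb.1.apply_vertexMap hj r).le
      · exact (sub_pos.1 (hr b hb j hj)).le
    · have h1 := (ht₁ (b, j)).1 (hφ0 b j hj)
      rw [← hφt b hb.1] at h1
      exact lt_of_le_of_ne (sub_nonneg.2 (hb.2 j)) h1.symm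
  have hsD : ∀ k, s k ∈ D := fun k b hb j => by
    have h1 : ∀ j, u j (vertexMap b (W b) fun i => ∑ k, s k i) ≤ ∑ k, s k j := fun j => by
      by_contra! hlt
      have h2 := (ht₁ (b, j)).2 (sub_neg.2 hlt)
      rw [← hφt b hb.1] at h2
      exact h2.not_ge (sub_nonneg.2 (hb.2 j))
    obtain ⟨y, hy, hsum⟩ := hs _ h1
    have h3 : ∀ i ∈ b, u i (y k) = s k i := fun i hi => by
      have := hb.1.apply_vertexMap hi fun i => ∑ k, s k i
      rw [hsum, map_sum] at this
      exact (Finset.sum_eq_sum_iff_of_le fun k _ => hy k i).1 this k (Finset.mem_univ _)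
    rw [hb.1.vertexMap_eq h3]
    exact hy k j
  have hpoly : ∀ r : ι → ℝ, polyhedron Finset.univ u (fun i => LinearMap.proj i) r =
      {x | ∀ i, u i x ≤ r i} := fun r => by
    ext
    simp [polyhedron]
  have hsub : ∀ r ∈ D, ∀ r' ∈ D, polyhedron Finset.univ u (fun i => LinearMap.proj i) (r + r') ⊆
      polyhedron Finset.univ u (fun i => LinearMap.proj i) r +
        polyhedron Finset.univ u (fun i => LinearMap.proj i) r' := by
    intro r hr r' hr' z hz
    by_contra hz'
    obtain ⟨f, a, hf, hfa⟩ := geometric_hahn_banach_closed_point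
      ((convex_polyhedron r).add (convex_polyhedron r'))
      ((hpoly r ▸ hcpt r).add (hpoly r' ▸ hcpt r')).isClosed hz'
    obtain ⟨b, hb, hmax⟩ := hcert f
    rw [hpoly] at hz
    have h1 := hmax _ z hz
    rw [map_add] at h1
    have h2 := hf (vertexMap b (W b) r + vertexMap b (W b) r') (Set.add_mem_add
      (by rw [hpoly]; exact hr b hb) (by rw [hpoly]; exact hr' b hb))
    exact absurd (h1.trans_lt h2) hfa.not_gt
  have hC := isOpenCone_interior hDadd hDsmul ⟨t, htD⟩
  refine ⟨interior D, t, hC, ⟨fun j _ k _ => by simp [Pi.single_apply], fun r hr => ?_,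
    fun r _ => hpoly r ▸ hcpt r, fun r hr r' hr' => hsub r (interior_subset hr) r'
      (interior_subset hr')⟩, fun i => (htpos i).le, htD, fun k ε hε =>
    ⟨add_mem_interior_of_mem hDadd (hsD k) (hC.smul_mem ε hε t htD), ?_⟩⟩
  · obtain ⟨b, hb, -⟩ := hcert 0
    rw [hpoly]
    exact ⟨_, interior_subset hr b hb⟩
  · rw [← polyhedron_smul hε]
    exact hsub _ (hsD k) _ (hDsmul ε hε t (interior_subset htD))

end

/-- The Minkowski–Weyl theorem: a full-dimensional polytope is cut out by finitely many of its
supporting half-spaces. -/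
theorem exists_finset_forall_mem_convexHull {n : ℕ} (F : Finset (Fin n → ℝ))
    (hF : (interior (convexHull ℝ (F : Set (Fin n → ℝ)))).Nonempty) :
    ∃ N : Finset ((Fin n → ℝ) →ₗ[ℝ] ℝ), ∀ x,
      (∀ f ∈ N, ∃ q ∈ convexHull ℝ (F : Set (Fin n → ℝ)), f x ≤ f q) →
        x ∈ convexHull ℝ (F : Set (Fin n → ℝ)) := by
  classical
  obtain ⟨c, hc⟩ := hF
  set Q := convexHull ℝ (F : Set (Fin n → ℝ)) with hQ
  let u : F → (Fin n → ℝ) →ₗ[ℝ] ℝ := fun v => dotProductEquiv ℝ (Fin n) (v.1 - c)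
  have hu : ∀ v y, u v y = (v.1 - c) ⬝ᵥ y := fun v y => rfl
  have hpolar : ∀ y, (∀ v, u v y ≤ 1) → ∀ q ∈ Q, (q - c) ⬝ᵥ y ≤ 1 := fun y hy q hq => by
    have hlin : IsLinearMap ℝ fun q : Fin n → ℝ => q ⬝ᵥ y :=
      ⟨fun a b => add_dotProduct a b y, fun r a => smul_dotProduct r a y⟩
    have : Q ⊆ {q | q ⬝ᵥ y ≤ 1 + c ⬝ᵥ y} := by
      refine convexHull_min (fun v hv => ?_) (convex_halfSpace_le hlin _)
      have := hy ⟨v, hv⟩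
      rw [hu, sub_dotProduct] at this
      exact sub_le_iff_le_add.1 this
    rw [sub_dotProduct]
    exact sub_le_iff_le_add.2 (this hq)
  have hcpt : IsCompact {y | ∀ v, u v y ≤ 1} := by
    obtain ⟨r, hr, hball⟩ := Metric.mem_nhds_iff.1 (mem_interior_iff_mem_nhds.1 hc)
    have hmem : ∀ i : Fin n, ∀ a : ℝ, |a| < r → c + a • Pi.single i 1 ∈ Q := fun i a ha => by
      refine hball ?_
      rw [Metric.mem_ball, dist_self_add_left, norm_smul, Pi.norm_single]
      simpa using ha
    refine (isCompact_closedBall (0 : Fin n → ℝ) (2 / r)).of_isClosed_subset ?_ fun y hy => ?_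
    · rw [Set.ofPred_forall]
      exact isClosed_iInter fun v =>
        isClosed_le (u v).continuous_of_finiteDimensional continuous_const
    · rw [mem_closedBall_zero_iff, pi_norm_le_iff_of_nonneg (by positivity)]
      intro i
      have h1 := hpolar y hy _ (hmem i (r / 2) (by rw [abs_of_pos] <;> linarith))
      have h2 := hpolar y hy _ (hmem i (-(r / 2)) (by rw [abs_neg, abs_of_pos] <;> linarith))
      simp only [add_sub_cancel_left, smul_dotProduct, single_dotProduct, one_mul, smul_eq_mul]
        at h1 h2
      rw [Real.norm_eq_abs, abs_le, le_div_iff₀ hr, ← neg_div, div_le_iff₀ hr]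
      constructor <;> linarith
  have hY : ∀ a : Finset F, ∃ y, (∃ y, (∀ i ∈ a, u i y = 1) ∧
      ∀ v, (∀ i ∈ a, u i v = 0) → v = 0) → (∀ i ∈ a, u i y = 1) := fun a => by
    by_cases h : ∃ y, (∀ i ∈ a, u i y = 1) ∧ ∀ v, (∀ i ∈ a, u i v = 0) → v = 0
    · exact ⟨h.choose, fun _ => h.choose_spec.1⟩
    · exact ⟨0, fun h' => absurd h' h⟩
  choose Y hY using hY
  refine ⟨Finset.univ.image fun a => dotProductEquiv ℝ (Fin n) (Y a), fun x hx => ?_⟩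
  by_contra hxQ
  have hcQ : c ∈ Q := interior_subset hc
  obtain ⟨f, α, hf, hfα⟩ := geometric_hahn_banach_closed_point (convex_convexHull ℝ _)
    (F.finite_toSet.isCompact_convexHull ℝ).isClosed hxQ
  set y := (dotProductEquiv ℝ (Fin n)).symm f with hy
  have hfy : ∀ w, f w = w ⬝ᵥ y := fun w => by
    rw [dotProduct_comm]
    exact (LinearMap.congr_fun ((dotProductEquiv ℝ (Fin n)).apply_symm_apply f) w).symm
  have hα : 0 < α - f c := sub_pos.2 (hf c hcQ)
  obtain ⟨z, hz, hmax, hinj⟩ := exists_isMax_forall_eq_zero (t := fun _ => 1) hcpt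
    ⟨0, fun v => by simp⟩ (dotProductEquiv ℝ (Fin n) (x - c))
  have h1 := hmax ((α - f c)⁻¹ • y) fun v => by
    rw [hu, dotProduct_smul, smul_eq_mul, inv_mul_le_iff₀ hα, mul_one, sub_dotProduct, ← hfy, ← hfy]
    have := hf v (subset_convexHull ℝ _ v.2)
    linarith
  have h2 : 1 < (x - c) ⬝ᵥ z := by
    refine lt_of_lt_of_le ?_ h1
    rw [dotProductEquiv_apply_apply, dotProduct_smul, smul_eq_mul, lt_inv_mul_iff₀ hα, mul_one,
      sub_dotProduct, ← hfy, ← hfy]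
    linarith
  set a : Finset F := Finset.univ.filter fun i => u i z = 1 with ha
  have haz : ∀ i ∈ a, u i z = 1 := fun i hi => by simpa [ha] using hi
  have hinj' : ∀ v, (∀ i ∈ a, u i v = 0) → v = 0 := fun v hv => hinj v (by simpa [ha] using hv)
  have hYz : Y a = z := sub_eq_zero.1 (hinj' _ fun i hi => by
    rw [map_sub, hY a ⟨z, haz, hinj'⟩ i hi, haz i hi, sub_self])
  obtain ⟨q, hq, hxq⟩ := hx _ (Finset.mem_image_of_mem _ (Finset.mem_univ a))
  rw [hYz, dotProductEquiv_apply_apply, dotProductEquiv_apply_apply] at hxq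
  have h3 := hpolar z hz q hq
  rw [sub_dotProduct, dotProduct_comm] at h2 h3
  rw [dotProduct_comm c] at h2
  linarith [dotProduct_comm c z]

section

variable {n : ℕ}

theorem exists_finset_subset_convexHull {K : Set (Fin n → ℝ)} (hne : K.Nonempty)
    (hcpt : IsCompact K) (hconv : Convex ℝ K) {ε : ℝ} (hε : 0 < ε) :
    ∃ F : Finset (Fin n → ℝ), K ⊆ convexHull ℝ (F : Set (Fin n → ℝ)) ∧
      convexHull ℝ (F : Set (Fin n → ℝ)) ⊆ K + Metric.closedBall 0 ε ∧
      (interior (convexHull ℝ (F : Set (Fin n → ℝ)))).Nonempty := by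
  obtain ⟨A, hAK, hAfin, hA⟩ := hcpt.finite_cover_balls hε
  let cube : Set (Fin n → ℝ) := Set.univ.pi fun _ => {-ε, ε}
  have hcube : convexHull ℝ cube = Metric.closedBall 0 ε := by
    rw [convexHull_pi, closedBall_pi _ hε.le]
    congr 1
    ext i : 1
    rw [convexHull_pair, segment_eq_Icc (by linarith), Pi.zero_apply, Real.closedBall_eq_Icc]
    simp
  have hfin : (A + cube).Finite := hAfin.add (Set.Finite.pi fun _ => by simp)
  obtain ⟨F, hF⟩ := hfin.exists_finset_coe
  have hsub : ∀ a ∈ A, Metric.closedBall a ε ⊆ convexHull ℝ A + Metric.closedBall 0 ε :=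
    fun a ha => by
    rw [← singleton_add_closedBall_zero]
    exact Set.add_subset_add_right (Set.singleton_subset_iff.2 (subset_convexHull ℝ A ha))
  refine ⟨F, ?_⟩
  rw [hF, convexHull_add, hcube]
  refine ⟨fun x hx => ?_, Set.add_subset_add_right (convexHull_min hAK hconv), ?_⟩
  · obtain ⟨a, ha, hxa⟩ := Set.mem_iUnion₂.1 (hA hx)
    exact hsub a ha (Metric.ball_subset_closedBall hxa)
  · obtain ⟨x, hx⟩ := hne
    obtain ⟨a, ha, -⟩ := Set.mem_iUnion₂.1 (hA hx)
    exact ⟨a, interior_maximal (Metric.ball_subset_closedBall.trans (hsub a ha)) Metric.isOpen_ball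
      (Metric.mem_ball_self hε)⟩

theorem exists_mem_apply_lt_of_mem_interior {Q : Set (Fin n → ℝ)} {c : Fin n → ℝ}
    (hc : c ∈ interior Q) {f : (Fin n → ℝ) →ₗ[ℝ] ℝ} (hf : f ≠ 0) : ∃ q ∈ Q, f c < f q := by
  obtain ⟨v, hv⟩ : ∃ v, 0 < f v := by
    by_contra! h
    refine hf (LinearMap.ext fun v => le_antisymm (h v) ?_)
    have := h (-v)
    rw [map_neg] at this
    simpa using this
  have hcont : Continuous fun r : ℝ => c + r • v := by fun_prop
  have hev : ∀ᶠ r : ℝ in nhdsWithin 0 (Set.Ioi 0), c + r • v ∈ Q := nhdsWithin_le_nhds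
    (hcont.continuousAt.eventually_mem (by simpa using mem_interior_iff_mem_nhds.1 hc))
  obtain ⟨r, h1, h2⟩ := (hev.and
    (self_mem_nhdsWithin : ∀ᶠ r : ℝ in nhdsWithin 0 (Set.Ioi 0), r ∈ Set.Ioi 0)).exists
  refine ⟨_, h1, ?_⟩
  have := mul_pos h2 hv
  rw [map_add, map_smul, smul_eq_mul]
  linarith

theorem isCompact_polyhedron_of_proj_mem {ι : Type} {u : ι → (Fin n → ℝ) →ₗ[ℝ] ℝ}
    (h₁ : ∀ i, LinearMap.proj i ∈ Set.range u) (h₂ : ∀ i, -LinearMap.proj i ∈ Set.range u)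
    (t : ι → ℝ) : IsCompact {x | ∀ i, u i x ≤ t i} := by
  choose a ha using h₁
  choose b hb using h₂
  refine (isCompact_Icc (a := fun i => -t (b i)) (b := fun i => t (a i))).of_isClosed_subset ?_
    fun x hx => ⟨fun i => ?_, fun i => ?_⟩
  · rw [Set.ofPred_forall]
    exact isClosed_iInter fun v =>
      isClosed_le (u v).continuous_of_finiteDimensional continuous_const
  · have := hx (b i)
    rw [hb] at this
    exact neg_le.1 this
  · have := hx (a i)
    rwa [ha] at this

/-- Simultaneous approximation of convex bodies by members of an additive system of polytopes. -/
theorem exists_isAdditiveSystem_approx {κ : Type} [Fintype κ] [Nonempty κ]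
    {K : κ → Set (Fin n → ℝ)} (hne : ∀ k, (K k).Nonempty) (hcpt : ∀ k, IsCompact (K k))
    (hconv : ∀ k, Convex ℝ (K k)) {ε : ℝ} (hε : 0 < ε) :
    ∃ (ι : Type) (_ : Fintype ι) (_ : DecidableEq ι) (C : Set (ι → ℝ))
      (u : ι → (Fin n → ℝ) →ₗ[ℝ] ℝ) (s : κ → ι → ℝ), IsOpenCone C ∧
      IsAdditiveSystem C Finset.univ u (fun i => LinearMap.proj i) ∧ ∀ k, s k ∈ C ∧
        K k ⊆ polyhedron Finset.univ u (fun i => LinearMap.proj i) (s k) ∧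
        polyhedron Finset.univ u (fun i => LinearMap.proj i) (s k) ⊆
          K k + Metric.closedBall 0 ε := by
  classical
  choose F hKF hFK hFint using fun k =>
    exists_finset_subset_convexHull (hne k) (hcpt k) (hconv k) (half_pos hε)
  set Q : κ → Set (Fin n → ℝ) := fun k => convexHull ℝ (F k : Set (Fin n → ℝ)) with hQ
  have hQcpt : ∀ k, IsCompact (Q k) := fun k => (F k).finite_toSet.isCompact_convexHull ℝ
  choose c hc using hFint
  have hcQ : ∀ k, c k ∈ Q k := fun k => interior_subset (hc k)
  have hsum : convexHull ℝ ((∑ k, F k : Finset (Fin n → ℝ)) : Set (Fin n → ℝ)) = ∑ k, Q k := by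
    rw [Finset.coe_sum, convexHull_sum]
  have hsumint : (interior (∑ k, Q k)).Nonempty := by
    obtain ⟨k⟩ := ‹Nonempty κ›
    rw [← Finset.add_sum_erase _ _ (Finset.mem_univ k)]
    exact ⟨_, subset_interior_add_left (Set.add_mem_add (hc k)
      (Set.finsetSum_mem_finsetSum _ _ c fun i _ => hcQ i))⟩
  choose N hN using fun k => exists_finset_forall_mem_convexHull (F k) ⟨c k, hc k⟩
  obtain ⟨M, hM⟩ := exists_finset_forall_mem_convexHull (∑ k, F k) (hsum ▸ hsumint)
  rw [hsum] at hM
  let T : Finset ((Fin n → ℝ) →ₗ[ℝ] ℝ) := (M ∪ Finset.univ.biUnion N ∪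
    Finset.univ.image (fun i : Fin n => LinearMap.proj i) ∪
    Finset.univ.image (fun i : Fin n => -LinearMap.proj i)).erase 0
  let u : T → (Fin n → ℝ) →ₗ[ℝ] ℝ := fun f => f
  have hu0 : ∀ i, u i ≠ 0 := fun i => (Finset.mem_erase.1 i.2).1
  have hq : ∀ k i, ∃ q ∈ Q k, ∀ y ∈ Q k, u i y ≤ u i q := fun k i =>
    (hQcpt k).exists_isMaxOn ⟨_, hcQ k⟩ (u i).continuous_of_finiteDimensional.continuousOn
  choose q hqQ hq using hq
  have hmemT : ∀ f, f ≠ 0 → f ∈ (M ∪ Finset.univ.biUnion N ∪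
      Finset.univ.image (fun i : Fin n => LinearMap.proj i) ∪
      Finset.univ.image (fun i : Fin n => -LinearMap.proj i)) → ∃ i, u i = f :=
    fun f hf0 hf => ⟨⟨f, Finset.mem_erase.2 ⟨hf0, hf⟩⟩, rfl⟩
  have hproj0 : ∀ i : Fin n, (LinearMap.proj i : (Fin n → ℝ) →ₗ[ℝ] ℝ) ≠ 0 := fun i h => by
    simpa using LinearMap.congr_fun h (Pi.single i 1)
  have hPQ : ∀ k x, (∀ i, u i x ≤ u i (q k i)) → x ∈ Q k := fun k x hx => hN k x fun f hf => by
    by_cases hf0 : f = 0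
    · exact ⟨_, hcQ k, by simp [hf0]⟩
    · obtain ⟨i, rfl⟩ := hmemT f hf0 (by
        simp only [Finset.mem_union, Finset.mem_biUnion]
        exact Or.inl (Or.inl (Or.inr ⟨k, Finset.mem_univ _, hf⟩)))
      exact ⟨_, hqQ k i, hx i⟩
  have hPQsum : ∀ x, (∀ i, u i x ≤ ∑ k, u i (q k i)) → x ∈ ∑ k, Q k := fun x hx =>
    hM x fun f hf => by
    by_cases hf0 : f = 0
    · exact ⟨∑ k, c k, Set.finsetSum_mem_finsetSum _ _ c fun i _ => hcQ i, by simp [hf0]⟩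
    · obtain ⟨i, rfl⟩ := hmemT f hf0 (by
        simp only [Finset.mem_union]
        exact Or.inl (Or.inl (Or.inl hf)))
      refine ⟨∑ k, q k i, Set.finsetSum_mem_finsetSum _ _ _ fun k _ => hqQ k i, ?_⟩
      rw [map_sum]
      exact hx i
  obtain ⟨C, t, hC, hsys, ht0, htC, hst⟩ := exists_isAdditiveSystem
    (isCompact_polyhedron_of_proj_mem (u := u)
      (fun i => hmemT _ (hproj0 i) (by simp))
      (fun i => hmemT _ (neg_ne_zero.2 (hproj0 i)) (by simp)))
    (s := fun k i => u i (q k i)) (x₀ := ∑ k, c k) (fun i => by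
      rw [map_sum]
      refine Finset.sum_lt_sum_of_nonempty Finset.univ_nonempty fun k _ => ?_
      obtain ⟨y, hy, hlt⟩ := exists_mem_apply_lt_of_mem_interior (hc k) (hu0 i)
      exact hlt.trans_le (hq k i y hy))
    (fun x hx => by
      obtain ⟨y, hy, rfl⟩ := (Set.mem_fintype_sum _ _).1 (hPQsum x hx)
      exact ⟨y, fun k i => hq k i _ (hy k), rfl⟩)
  obtain ⟨R, hR0, hR⟩ := (hsys.isCompact t htC).isBounded.exists_pos_norm_le
  have hδ : 0 < ε / 2 / R := by positivity
  refine ⟨T, inferInstance, inferInstance, C, u, fun k => (fun i => u i (q k i)) + (ε / 2 / R) • t,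
    hC, hsys, fun k => ⟨(hst k _ hδ).1, fun x hx i _ => ?_, (hst k _ hδ).2.trans ?_⟩⟩
  · have h1 := hq k i x (hKF k hx)
    have h2 := mul_nonneg hδ.le (ht0 i)
    simp only [LinearMap.proj_apply, Pi.add_apply, Pi.smul_apply, smul_eq_mul]
    linarith
  · refine Set.add_subset_iff.2 fun x hx y hy => ?_
    obtain ⟨y, hy, rfl⟩ := hy
    obtain ⟨a, ha, b, hb, rfl⟩ := hFK k (hPQ k x fun i => hx i (Finset.mem_univ i))
    change a + b + _ ∈ _
    rw [add_assoc]
    refine Set.add_mem_add ha ?_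
    rw [mem_closedBall_zero_iff] at hb ⊢
    refine (norm_add_le _ _).trans ?_
    have : ‖(ε / 2 / R) • y‖ ≤ ε / 2 := by
      rw [norm_smul, Real.norm_of_nonneg hδ.le]
      calc ε / 2 / R * ‖y‖ ≤ ε / 2 / R * R := mul_le_mul_of_nonneg_left (hR y hy) hδ.le
        _ = ε / 2 := by field_simp
    exact (add_le_add hb this).trans (by linarith)

end

section

variable {d : ℕ}

/-- The mixed volume with respect to the Lebesgue measure on `Fin d → ℝ`. -/
noncomputable def piMixedVolume (K : Fin d → Set (Fin d → ℝ)) : ℝ :=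
  ∑ S : Finset (Fin d), (-1 : ℝ) ^ (d - S.card) * (volume (∑ i ∈ S, K i)).toReal

theorem mixedVolume_eq_piMixedVolume (P : Fin d → Set (EuclideanSpace ℝ (Fin d))) :
    mixedVolume P = piMixedVolume fun i => WithLp.linearEquiv 2 ℝ (Fin d → ℝ) '' P i := by
  refine Finset.sum_congr rfl fun S _ => ?_
  rw [← Set.image_finsetSum]
  congr 2
  have h := (EuclideanSpace.volume_preserving_symm_measurableEquiv_toLp (Fin d)).symm
  have h2 := h.measure_preimage_equiv (∑ i ∈ S, P i)
  rw [← h2]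
  congr 1
  exact ((WithLp.linearEquiv 2 ℝ (Fin d → ℝ)).toEquiv.image_eq_preimage_symm _).symm

theorem tendsto_piMixedVolume {K : Fin d → Set (Fin d → ℝ)} (hK : ∀ i, IsCompact (K i))
    {L : ℕ → Fin d → Set (Fin d → ℝ)} {δ : ℕ → ℝ} (hδ : Filter.Tendsto δ Filter.atTop (nhds 0))
    (hδ0 : ∀ m, 0 ≤ δ m) (hKL : ∀ m i, K i ⊆ L m i)
    (hLK : ∀ m i, L m i ⊆ K i + Metric.closedBall 0 (δ m)) :
    Filter.Tendsto (fun m => piMixedVolume (L m)) Filter.atTop (nhds (piMixedVolume K)) := by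
  have hsum : ∀ S : Finset (Fin d), IsCompact (∑ i ∈ S, K i) := fun S => by
    induction S using Finset.cons_induction with
    | empty => simp
    | cons a s ha ih =>
      rw [Finset.sum_cons]
      exact (hK a).add ih
  refine tendsto_finsetSum _ fun S _ => Filter.Tendsto.const_mul _ ?_
  have hcpt := hsum S
  have hlim : Filter.Tendsto (fun m => volume (Metric.cthickening (S.card * δ m) (∑ i ∈ S, K i)))
      Filter.atTop (nhds (volume (∑ i ∈ S, K i))) :=
    (tendsto_measure_cthickening_of_isCompact hcpt).comp (by simpa using hδ.const_mul (S.card : ℝ))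
  refine (ENNReal.tendsto_toReal hcpt.measure_lt_top.ne).comp
    (tendsto_of_tendsto_of_tendsto_of_le_of_le tendsto_const_nhds hlim (fun m => ?_) fun m => ?_)
  · exact measure_mono (Set.finsetSum_subset_finsetSum _ _ _ fun i _ => hKL m i)
  · refine measure_mono fun x hx => ?_
    rw [← hcpt.add_closedBall_zero (by have := hδ0 m; positivity)]
    obtain ⟨g, hg, rfl⟩ := (Set.mem_finsetSum _ _ _).1 hx
    have hab : ∀ i, ∃ a b, i ∈ S → a ∈ K i ∧ ‖b‖ ≤ δ m ∧ a + b = g i := fun i => by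
      by_cases hi : i ∈ S
      · obtain ⟨a, ha, b, hb, hab⟩ := hLK m i (hg hi)
        exact ⟨a, b, fun _ => ⟨ha, by simpa using hb, hab⟩⟩
      · exact ⟨0, 0, fun h => absurd h hi⟩
    choose a b hab using hab
    rw [← Finset.sum_congr rfl fun i hi => (hab i hi).2.2, Finset.sum_add_distrib]
    refine Set.add_mem_add (Set.finsetSum_mem_finsetSum _ _ _ fun i hi => (hab i hi).1) ?_
    rw [mem_closedBall_zero_iff]
    refine (norm_sum_le_of_le _ fun i hi => (hab i hi).2.1).trans ?_
    simp

variable {ι : Type} [Fintype ι] [DecidableEq ι] {C : Set (ι → ℝ)} {J : Finset ι}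
  {u : ι → (Fin d → ℝ) →ₗ[ℝ] ℝ} {τ : ι → (ι → ℝ) →ₗ[ℝ] ℝ}

theorem IsAdditiveSystem.sum_polyhedron (h : IsAdditiveSystem C J u τ) (hC : IsOpenCone C)
    {κ : Type} {S : Finset κ} (hS : S.Nonempty) {s : κ → ι → ℝ} (hs : ∀ k, s k ∈ C) :
    ∑ k ∈ S, s k ∈ C ∧ ∑ k ∈ S, polyhedron J u τ (s k) = polyhedron J u τ (∑ k ∈ S, s k) := by
  induction hS using Finset.Nonempty.cons_induction with
  | singleton a => simpa using hs a
  | cons a S ha hS ih =>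
    rw [Finset.sum_cons, Finset.sum_cons, ih.2]
    refine ⟨hC.add_mem _ (hs a) _ ih.1, Set.Subset.antisymm (Set.add_subset_iff.2 fun x hx y hy =>
      add_mem_polyhedron hx hy) (h.subset_add _ (hs a) _ ih.1)⟩

theorem IsAdditiveSystem.piMixedVolume_eq_polar (h : IsAdditiveSystem C J u τ) (hC : IsOpenCone C)
    (hd : d ≠ 0) {p : MvPolynomial ι ℝ} (hp : p.IsHomogeneous d)
    (hvol : ∀ t ∈ C, (volume (polyhedron J u τ t)).toReal = MvPolynomial.eval t p)
    {s : Fin d → ι → ℝ} (hs : ∀ k, s k ∈ C) :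
    piMixedVolume (fun i => polyhedron J u τ (s i)) =
      MvPolynomial.polar ((List.finRange d).map s) p := by
  rw [← hp.sum_finset_eq_polar]
  refine Finset.sum_congr rfl fun S _ => ?_
  congr 1
  rcases S.eq_empty_or_nonempty with rfl | hS
  · have : Nonempty (Fin d) := ⟨⟨0, Nat.pos_of_ne_zero hd⟩⟩
    have h0 := hp.eval_smul 0 0
    rw [zero_smul, zero_pow hd, zero_mul] at h0
    rw [Finset.sum_empty, Finset.sum_empty, h0]
    simp [← Set.singleton_zero]
  · obtain ⟨h1, h2⟩ := h.sum_polyhedron hC hS hs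
    rw [h2, hvol _ h1]

end

/-- The Alexandrov–Fenchel inequality for members of an additive system. -/
theorem IsAdditiveSystem.piMixedVolume_mul_le {n : ℕ} {ι : Type} [Fintype ι] [DecidableEq ι]
    {C : Set (ι → ℝ)} {J : Finset ι} {u : ι → (Fin (n + 2) → ℝ) →ₗ[ℝ] ℝ}
    {τ : ι → (ι → ℝ) →ₗ[ℝ] ℝ} (h : IsAdditiveSystem C J u τ) (hC : IsOpenCone C)
    {s : Fin (n + 2) → ι → ℝ} (hs : ∀ k, s k ∈ C) :
    piMixedVolume (fun i => polyhedron J u τ (s (Function.update id 1 0 i))) *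
      piMixedVolume (fun i => polyhedron J u τ (s (Function.update id 0 1 i))) ≤
        piMixedVolume (fun i => polyhedron J u τ (s i)) ^ 2 := by
  obtain ⟨p, hp, hvol⟩ := IsAdditiveSystem.exists_isLorentzianOn hC h
  have hlist : ∀ s : Fin (n + 2) → ι → ℝ, (List.finRange (n + 2)).map s =
      s 0 :: s 1 :: (List.finRange n).map fun i => s i.succ.succ := fun s => by
    simp [List.finRange_succ, Function.comp_def]
  have heq := fun {s : Fin (n + 2) → ι → ℝ} (hs : ∀ k, s k ∈ C) =>
    h.piMixedVolume_eq_polar hC (by omega) hp.isHomogeneous hvol hs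
  rw [heq hs, heq fun k => hs (Function.update id 1 0 k),
    heq fun k => hs (Function.update id 0 1 k),
    hlist, hlist, hlist]
  have h1 : ∀ i : Fin n, i.succ.succ ≠ 1 := fun i => by simp [Fin.ext_iff]
  simpa [h1, Function.update_apply] using
    hp.polar_mul_le ((List.finRange n).map fun i => s i.succ.succ) (by simp [hs]) (by simp)
      (s 1) (hs 1) (s 0)

theorem piMixedVolume_mul_le {n : ℕ} {K : Fin (n + 2) → Set (Fin (n + 2) → ℝ)}
    (hne : ∀ i, (K i).Nonempty) (hcpt : ∀ i, IsCompact (K i)) (hconv : ∀ i, Convex ℝ (K i)) :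
    piMixedVolume (fun i => K (Function.update id 1 0 i)) *
      piMixedVolume (fun i => K (Function.update id 0 1 i)) ≤ piMixedVolume K ^ 2 := by
  have hL : ∀ m : ℕ, ∃ L : Fin (n + 2) → Set (Fin (n + 2) → ℝ), (∀ i, K i ⊆ L i) ∧
      (∀ i, L i ⊆ K i + Metric.closedBall 0 (1 / ((m : ℝ) + 1))) ∧
      piMixedVolume (fun i => L (Function.update id 1 0 i)) *
        piMixedVolume (fun i => L (Function.update id 0 1 i)) ≤ piMixedVolume L ^ 2 := fun m => by
    obtain ⟨ι, _, _, C, u, s, hC, h, hs⟩ := exists_isAdditiveSystem_approx hne hcpt hconv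
      (Nat.one_div_pos_of_nat (α := ℝ) (n := m))
    exact ⟨fun i => polyhedron Finset.univ u (fun i => LinearMap.proj i) (s i), fun i => (hs i).2.1,
      fun i => (hs i).2.2, h.piMixedVolume_mul_le hC fun i => (hs i).1⟩
  choose L hKL hLK hAF using hL
  have hlim := fun σ : Fin (n + 2) → Fin (n + 2) => tendsto_piMixedVolume (fun i => hcpt (σ i))
    (tendsto_one_div_add_atTop_nhds_zero_nat (𝕜 := ℝ)) (fun m => Nat.one_div_pos_of_nat.le)
    (fun m i => hKL m (σ i)) fun m i => hLK m (σ i)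
  exact le_of_tendsto_of_tendsto' ((hlim _).mul (hlim _)) ((hlim id).pow 2) hAF

/-- Aleksandrov–Fenchel inequality: for convex bodies `P_1, …, P_d` in `ℝ^d`,
`d = n + 2 ≥ 2`,
`V(P_1, P_2, P_3, …, P_d)^2 ≥ V(P_1, P_1, P_3, …, P_d) ⬝ V(P_2, P_2, P_3, …, P_d)`. -/
theorem mixedVolume_alexandrov_fenchel (n : ℕ)
    (P : Fin (n + 2) → Set (EuclideanSpace ℝ (Fin (n + 2))))
    (hne : ∀ i, (P i).Nonempty) (hcpt : ∀ i, IsCompact (P i)) (hconv : ∀ i, Convex ℝ (P i)) :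
    mixedVolume P ^ 2 ≥
      mixedVolume (Function.update P 1 (P 0)) * mixedVolume (Function.update P 0 (P 1)) := by
  have hK := @piMixedVolume_mul_le n (fun i => WithLp.linearEquiv 2 ℝ (Fin (n + 2) → ℝ) '' P i)
    (fun i => (hne i).image _) (fun i => (hcpt i).image (PiLp.continuous_ofLp 2 _))
    fun i => (hconv i).linear_image (WithLp.linearEquiv 2 ℝ (Fin (n + 2) → ℝ)).toLinearMap
  have hP : ∀ a b, Function.update P a (P b) = fun i => P (Function.update id a b i) := fun a b =>
    (Function.comp_update P id a b).symm
  rw [ge_iff_le, hP, hP]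
  simpa only [mixedVolume_eq_piMixedVolume] using hK
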